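/- arXiv:2605.31583 — 2 statements merged into one kernel-verified Lean document; each statement's English description precedes it below -/
import Mathlib

section
/- Let α > 0 and δ > 0 be fixed, and set A(n) = √(4(1+δ)α (log n)/n). Then lim_{n→∞} (log R_n(A(n))) / (log |S|) = −δ²/(4(1+δ)), where |S| = C(N, n)² is the number of n×n product subsets of [N]×[N] with N = ⌊n^{1+α}⌋. In particular this holds in the sparse regime α + δ > 1/2, where A(n) = A*(δ, α; n) = min{ n^{-(1-α-δ)}, √(4(1+δ)α (log n)/n) }. -/
open MeasureTheory ProbabilityTheory Real Filter Topology

noncomputable section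

/-- Law of the N×N Gaussian observation matrix with mean matrix θ and unit variances. -/
def PTheta (N : ℕ) (θ : Fin N → Fin N → ℝ) : Measure (Fin N → Fin N → ℝ) :=
  Measure.pi fun i => Measure.pi fun j => gaussianReal (θ i j) 1

/-- Parameter space Θ(A, n, N). -/
def ThetaSet (A : ℝ) (n N : ℕ) : Set (Fin N → Fin N → ℝ) :=
  {θ | ∃ R C : Finset (Fin N), R.card = n ∧ C.card = n ∧
    (∀ i j, i ∈ R → j ∈ C → A ≤ θ i j) ∧
    (∀ i j, ¬(i ∈ R ∧ j ∈ C) → θ i j = 0)}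

/-- Risk of the test with rejection region `T`: type-I error plus worst-case type-II error. -/
def testRisk (n N : ℕ) (A : ℝ) (T : Set (Fin N → Fin N → ℝ)) : ℝ :=
  (PTheta N 0 T).toReal + ⨆ θ : ThetaSet A n N, (PTheta N θ.1 Tᶜ).toReal

/-- Minimax risk over all (measurable) tests. -/
def minimaxRisk (n N : ℕ) (A : ℝ) : ℝ :=
  ⨅ T : {T : Set (Fin N → Fin N → ℝ) // MeasurableSet T}, testRisk n N A T.1


lemma gauss_shift (m c : ℝ) : gaussianReal (m + c) 1 =
    (gaussianReal m 1).withDensity (fun x => ENNReal.ofReal (Real.exp (c * (x - m) - c ^ 2 / 2))) := by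
  rw [gaussianReal_of_var_ne_zero _ one_ne_zero, gaussianReal_of_var_ne_zero _ one_ne_zero,
    ← withDensity_mul _ (measurable_gaussianPDF _ _) (by fun_prop)]
  congr 1
  ext x
  simp only [gaussianPDF, Pi.mul_apply, gaussianPDFReal]
  rw [← ENNReal.ofReal_mul (by positivity), mul_assoc (√_)⁻¹, ← Real.exp_add]
  congr 3
  push_cast
  ring

lemma lintegral_pi_prod {ι : Type*} [Fintype ι] {Ω : ι → Type*} [∀ i, MeasurableSpace (Ω i)]
    (μ : ∀ i, Measure (Ω i)) [∀ i, IsProbabilityMeasure (μ i)] (f : ∀ i, Ω i → ENNReal)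
    (hf : ∀ i, Measurable (f i)) :
    ∫⁻ x, ∏ i, f i (x i) ∂(Measure.pi μ) = ∏ i, ∫⁻ y, f i y ∂(μ i) := by
  have h := lintegral_prod_eq_prod_lintegral_of_indepFun (μ := Measure.pi μ) Finset.univ
    (fun i (x : ∀ i, Ω i) => f i (x i)) (iIndepFun_pi (μ := μ) (fun i => (hf i).aemeasurable))
    (fun i => (hf i).comp (measurable_pi_apply i))
  rw [h]
  refine Finset.prod_congr rfl fun i _ => ?_
  exact (measurePreserving_eval μ i).lintegral_comp (hf i)

lemma pi_density {ι : Type*} [Fintype ι] {Ω : ι → Type*} [∀ i, MeasurableSpace (Ω i)]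
    (μ ν : ∀ i, Measure (Ω i)) [∀ i, IsProbabilityMeasure (μ i)] [∀ i, IsProbabilityMeasure (ν i)]
    (f : ∀ i, Ω i → ENNReal) (hf : ∀ i, Measurable (f i)) (h : ∀ i, ν i = (μ i).withDensity (f i)) :
    Measure.pi ν = (Measure.pi μ).withDensity (fun x => ∏ i, f i (x i)) := by
  refine Measure.pi_eq fun s hs => ?_
  rw [withDensity_apply _ (MeasurableSet.univ_pi hs), ← lintegral_indicator (MeasurableSet.univ_pi hs)]
  have : (Set.univ.pi s).indicator (fun x => ∏ i, f i (x i)) =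
      fun x => ∏ i, (s i).indicator (f i) (x i) := by
    ext x
    by_cases hx : x ∈ Set.univ.pi s
    · rw [Set.indicator_of_mem hx]
      refine Finset.prod_congr rfl fun i _ => ?_
      rw [Set.indicator_of_mem (hx i (Set.mem_univ i))]
    · rw [Set.indicator_of_notMem hx]
      have : ∃ i, x i ∉ s i := by
        simpa [Set.mem_pi] using hx
      obtain ⟨i, hi⟩ := this
      exact (Finset.prod_eq_zero (Finset.mem_univ i) (Set.indicator_of_notMem hi _)).symm
  rw [this, lintegral_pi_prod μ (fun i => (s i).indicator (f i)) fun i => (hf i).indicator (hs i)]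
  refine Finset.prod_congr rfl fun i _ => ?_
  rw [lintegral_indicator (hs i), h i, withDensity_apply _ (hs i)]

/-- Entrywise inner product of matrices. -/
def ip {N : ℕ} (c x : Fin N → Fin N → ℝ) : ℝ := ∑ i, ∑ j, c i j * x i j

lemma ip_measurable {N : ℕ} (c : Fin N → Fin N → ℝ) : Measurable (ip c) := by
  unfold ip
  fun_prop

lemma ip_sub {N : ℕ} (c x y : Fin N → Fin N → ℝ) : ip c (x - y) = ip c x - ip c y := by
  simp [ip, mul_sub, Finset.sum_sub_distrib]

lemma ip_add_left {N : ℕ} (c d x : Fin N → Fin N → ℝ) : ip (c + d) x = ip c x + ip d x := by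
  simp [ip, add_mul, Finset.sum_add_distrib]

lemma ip_smul_left {N : ℕ} (a : ℝ) (c x : Fin N → Fin N → ℝ) : ip (a • c) x = a * ip c x := by
  simp [ip, Finset.mul_sum, mul_assoc]

lemma ip_comm {N : ℕ} (c x : Fin N → Fin N → ℝ) : ip c x = ip x c := by
  simp [ip, mul_comm]

lemma ip_zero {N : ℕ} (c : Fin N → Fin N → ℝ) : ip c 0 = 0 := by
  simp [ip]

instance PTheta_prob (N : ℕ) (θ : Fin N → Fin N → ℝ) : IsProbabilityMeasure (PTheta N θ) := by
  unfold PTheta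
  infer_instance

lemma PTheta_shift {N : ℕ} (θ c : Fin N → Fin N → ℝ) :
    PTheta N (θ + c) = (PTheta N θ).withDensity
      (fun x => ENNReal.ofReal (Real.exp (ip c (x - θ) - ip c c / 2))) := by
  unfold PTheta
  have h1 : ∀ i, (Measure.pi fun j => gaussianReal ((θ + c) i j) 1) =
      (Measure.pi fun j => gaussianReal (θ i j) 1).withDensity
        (fun x => ∏ j, ENNReal.ofReal (Real.exp (c i j * (x j - θ i j) - (c i j) ^ 2 / 2))) :=
    fun i => pi_density (fun j => gaussianReal (θ i j) 1) (fun j => gaussianReal ((θ + c) i j) 1)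
      (fun j y => ENNReal.ofReal (Real.exp (c i j * (y - θ i j) - (c i j) ^ 2 / 2)))
      (fun j => by fun_prop) (fun j => gauss_shift (θ i j) (c i j))
  have h2 := pi_density (fun i => Measure.pi fun j => gaussianReal (θ i j) 1)
    (fun i => Measure.pi fun j => gaussianReal ((θ + c) i j) 1)
    (fun i (x : Fin N → ℝ) => ∏ j, ENNReal.ofReal (Real.exp (c i j * (x j - θ i j) - (c i j) ^ 2 / 2)))
    (fun i => Finset.measurable_prod _ fun j _ => by fun_prop) h1
  refine h2.trans ?_
  congr 1
  ext x
  simp_rw [← ENNReal.ofReal_prod_of_nonneg (fun _ _ => (Real.exp_pos _).le), ← Real.exp_sum]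
  rw [← ENNReal.ofReal_prod_of_nonneg (fun _ _ => (Real.exp_pos _).le), ← Real.exp_sum]
  congr 2
  simp only [ip, Finset.sum_div, ← Finset.sum_sub_distrib, Pi.sub_apply]
  refine Finset.sum_congr rfl fun i _ => Finset.sum_congr rfl fun j _ => ?_
  ring

/-- Lower bound of a shifted probability. -/
lemma shift_ge {N : ℕ} (θ c : Fin N → Fin N → ℝ) (E : Set (Fin N → Fin N → ℝ))
    (hE : MeasurableSet E) (u : ℝ) (hu : ∀ x ∈ E, u ≤ ip c (x - θ)) :
    Real.exp (u - ip c c / 2) * (PTheta N θ).real E ≤ (PTheta N (θ + c)).real E := by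
  have : ENNReal.ofReal (Real.exp (u - ip c c / 2)) * PTheta N θ E ≤ PTheta N (θ + c) E := by
    rw [PTheta_shift, withDensity_apply _ hE, ← setLIntegral_const]
    refine setLIntegral_mono' hE fun x hx => ?_
    gcongr
    exact hu x hx
  have h2 := ENNReal.toReal_mono (measure_ne_top _ _) this
  rwa [ENNReal.toReal_mul, ENNReal.toReal_ofReal (Real.exp_pos _).le] at h2

lemma shift_le {N : ℕ} (θ c : Fin N → Fin N → ℝ) (E : Set (Fin N → Fin N → ℝ))
    (hE : MeasurableSet E) (u : ℝ) (hu : ∀ x ∈ E, ip c (x - θ) ≤ u) :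
    (PTheta N (θ + c)).real E ≤ Real.exp (u - ip c c / 2) * (PTheta N θ).real E := by
  have : PTheta N (θ + c) E ≤ ENNReal.ofReal (Real.exp (u - ip c c / 2)) * PTheta N θ E := by
    rw [PTheta_shift, withDensity_apply _ hE, ← setLIntegral_const]
    refine setLIntegral_mono' hE fun x hx => ?_
    gcongr
    exact hu x hx
  have h2 := ENNReal.toReal_mono (ENNReal.mul_ne_top ENNReal.ofReal_ne_top (measure_ne_top _ _)) this
  rwa [ENNReal.toReal_mul, ENNReal.toReal_ofReal (Real.exp_pos _).le] at h2

lemma chernoff {N : ℕ} (θ c : Fin N → Fin N → ℝ) (E : Set (Fin N → Fin N → ℝ))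
    (hE : MeasurableSet E) (u : ℝ) (hu : ∀ x ∈ E, u ≤ ip c (x - θ)) :
    (PTheta N θ).real E ≤ Real.exp (-u + ip c c / 2) := by
  have h := (shift_ge θ c E hE u hu).trans measureReal_le_one
  rw [show -u + ip c c / 2 = -(u - ip c c / 2) by ring, Real.exp_neg, ← one_div,
    le_div_iff₀ (Real.exp_pos _), mul_comm]
  exact h

/-- Indicator matrix of the product set R × C. -/
def ind {N : ℕ} (R C : Finset (Fin N)) : Fin N → Fin N → ℝ :=
  fun i j => if i ∈ R ∧ j ∈ C then 1 else 0

lemma ip_ind {N : ℕ} (R C : Finset (Fin N)) (x : Fin N → Fin N → ℝ) :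
    ip (ind R C) x = ∑ i ∈ R, ∑ j ∈ C, x i j := by
  classical
  simp only [ip, ind, ite_and, ite_mul, one_mul, zero_mul]
  rw [← Finset.sum_filter_add_sum_filter_not Finset.univ (fun i => i ∈ R)]
  rw [Finset.sum_eq_zero (s := Finset.univ.filter (fun i => i ∉ R)), add_zero]
  · rw [Finset.filter_mem_eq_inter, Finset.univ_inter]
    refine Finset.sum_congr rfl fun i hi => ?_
    simp [hi]
  · intro i hi
    simp at hi
    simp [hi]

lemma ip_ind_ind {N : ℕ} (R C R' C' : Finset (Fin N)) :
    ip (ind R C) (ind R' C') = ((R ∩ R').card : ℝ) * (C ∩ C').card := by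
  rw [ip_ind]
  simp only [ind, ite_and]
  have : ∀ i, (∑ j ∈ C, if i ∈ R' then (if j ∈ C' then (1:ℝ) else 0) else 0) =
     if i ∈ R' then ((C ∩ C').card : ℝ) else 0 := by
    intro i
    split_ifs with h
    · simp
    · simp
  simp_rw [this]
  rw [← Finset.sum_filter, Finset.filter_mem_eq_inter]
  simp

/-- The family of pairs (R, C) of n-subsets. -/
def Sfam (n N : ℕ) : Finset (Finset (Fin N) × Finset (Fin N)) :=
  Finset.powersetCard n Finset.univ ×ˢ Finset.powersetCard n Finset.univ

lemma card_Sfam (n N : ℕ) : (Sfam n N).card = (N.choose n) ^ 2 := by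
  simp [Sfam, sq]

lemma mem_Sfam {n N : ℕ} {S : Finset (Fin N) × Finset (Fin N)} :
    S ∈ Sfam n N ↔ S.1.card = n ∧ S.2.card = n := by
  simp [Sfam, Finset.mem_powersetCard]

/-- Scan event for a single pair. -/
def scan1 (n N : ℕ) (t : ℝ) (S : Finset (Fin N) × Finset (Fin N)) : Set (Fin N → Fin N → ℝ) :=
  {x | n * t ≤ ip (ind S.1 S.2) x}

/-- Scan event. -/
def scanE (n N : ℕ) (t : ℝ) : Set (Fin N → Fin N → ℝ) :=
  ⋃ S ∈ Sfam n N, scan1 n N t S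

lemma scan1_meas (n N : ℕ) (t : ℝ) (S : Finset (Fin N) × Finset (Fin N)) :
    MeasurableSet (scan1 n N t S) :=
  measurableSet_le measurable_const (ip_measurable _)

lemma scanE_meas (n N : ℕ) (t : ℝ) : MeasurableSet (scanE n N t) :=
  Finset.measurableSet_biUnion _ fun S _ => scan1_meas n N t S

lemma ip_ind_self {n N : ℕ} {S : Finset (Fin N) × Finset (Fin N)} (hS : S ∈ Sfam n N) :
    ip (ind S.1 S.2) (ind S.1 S.2) = (n : ℝ) ^ 2 := by
  rw [mem_Sfam] at hS
  rw [ip_ind_ind, Finset.inter_self, Finset.inter_self, hS.1, hS.2, sq]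

lemma ip_smul_smul {N : ℕ} (a : ℝ) (c : Fin N → Fin N → ℝ) :
    ip (a • c) (a • c) = a ^ 2 * ip c c := by
  rw [ip_smul_left, ip_comm, ip_smul_left]
  ring

lemma typeI {n N : ℕ} (hn : 0 < n) {t : ℝ} (ht : 0 < t) :
    (PTheta N 0).real (scanE n N t) ≤ (N.choose n : ℝ) ^ 2 * Real.exp (-(t ^ 2 / 2)) := by
  have hn' : (0:ℝ) < n := by exact_mod_cast hn
  refine (measureReal_biUnion_finset_le _ _).trans ?_
  have : ∀ S ∈ Sfam n N, (PTheta N 0).real (scan1 n N t S) ≤ Real.exp (-(t ^ 2 / 2)) := by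
    intro S hS
    have h := chernoff 0 ((t / n) • ind S.1 S.2) (scan1 n N t S) (scan1_meas _ _ _ _) (t ^ 2) ?_
    · rw [ip_smul_smul, ip_ind_self hS] at h
      refine h.trans (le_of_eq ?_)
      congr 1
      field_simp
      ring
    · intro x hx
      rw [sub_zero, ip_smul_left]
      have hx' : n * t ≤ ip (ind S.1 S.2) x := hx
      calc t ^ 2 = (t / n) * (n * t) := by field_simp
        _ ≤ _ := by gcongr
  refine (Finset.sum_le_sum this).trans (le_of_eq ?_)
  rw [Finset.sum_const, card_Sfam, nsmul_eq_mul]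
  push_cast
  ring

lemma typeII {n N : ℕ} (hn : 0 < n) {t A : ℝ} (hA : t ≤ A * n)
    (θ : Fin N → Fin N → ℝ) (hθ : θ ∈ ThetaSet A n N) :
    (PTheta N θ).real (scanE n N t)ᶜ ≤ Real.exp (-((A * n - t) ^ 2 / 2)) := by
  have hn' : (0:ℝ) < n := by exact_mod_cast hn
  obtain ⟨R, C, hR, hC, h1, h2⟩ := hθ
  have hS : (R, C) ∈ Sfam n N := mem_Sfam.2 ⟨hR, hC⟩
  have hm : A * n ^ 2 ≤ ip (ind R C) θ := by
    rw [ip_ind]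
    calc A * n ^ 2 = ∑ i ∈ R, ∑ j ∈ C, A := by simp [hR, hC]; ring
      _ ≤ _ := Finset.sum_le_sum fun i hi => Finset.sum_le_sum fun j hj => h1 i j hi hj
  have h := chernoff θ ((-(A - t / n)) • ind R C) (scan1 n N t (R, C))ᶜ
    (scan1_meas _ _ _ _).compl ((A * n - t) ^ 2) ?_
  · rw [ip_smul_smul, ip_ind_self (S := (R, C)) hS] at h
    refine (measureReal_mono ?_).trans (h.trans (le_of_eq ?_))
    · exact Set.compl_subset_compl.2 (Set.subset_biUnion_of_mem (u := scan1 n N t) hS)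
    · congr 1
      field_simp
      ring
  · intro x hx
    rw [ip_smul_left, ip_sub]
    have hx' : ip (ind R C) x < n * t := by
      simpa [scan1] using hx
    have hl : 0 ≤ A - t / n := by
      rw [sub_nonneg, div_le_iff₀ hn']; exact hA
    calc (A * n - t) ^ 2 = (A - t / n) * (A * n ^ 2 - n * t) := by field_simp
      _ ≤ (A - t / n) * (ip (ind R C) θ - ip (ind R C) x) := by gcongr
      _ = _ := by ring

lemma testRisk_nonneg (n N : ℕ) (A : ℝ) (T : Set (Fin N → Fin N → ℝ)) : 0 ≤ testRisk n N A T :=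
  add_nonneg ENNReal.toReal_nonneg (Real.iSup_nonneg fun _ => ENNReal.toReal_nonneg)

lemma risk_upper {n N : ℕ} (hn : 0 < n) {t A : ℝ} (ht : 0 < t) (hA : t ≤ A * n) :
    minimaxRisk n N A ≤ (N.choose n : ℝ) ^ 2 * Real.exp (-(t ^ 2 / 2)) +
      Real.exp (-((A * n - t) ^ 2 / 2)) := by
  refine (ciInf_le ⟨0, ?_⟩ (⟨scanE n N t, scanE_meas n N t⟩ :
    {T : Set (Fin N → Fin N → ℝ) // MeasurableSet T})).trans ?_
  · rintro _ ⟨T, rfl⟩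
    exact testRisk_nonneg _ _ _ _
  · exact add_le_add (typeI hn ht)
      (Real.iSup_le (fun θ => typeII hn hA θ.1 θ.2) (Real.exp_pos _).le)

lemma second_moment {Ω ι : Type*} [MeasurableSpace Ω] (μ : Measure Ω) [IsProbabilityMeasure μ]
    (s : Finset ι) (B : ι → Set Ω) (hB : ∀ i, MeasurableSet (B i)) (p q : ℝ) (hp : 0 ≤ p)
    (hq : 0 < q) (h1 : ∀ i ∈ s, p ≤ μ.real (B i))
    (h2 : ∀ i ∈ s, ∑ j ∈ s, μ.real (B i ∩ B j) ≤ q) :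
    s.card * p ^ 2 / q ≤ μ.real (⋃ i ∈ s, B i) := by
  set l := p / q
  have hl : 0 ≤ l := by positivity
  have key : ∀ x, 2 * l * (∑ i ∈ s, (B i).indicator (fun _ => (1:ℝ)) x)
      - l ^ 2 * (∑ i ∈ s, ∑ j ∈ s, (B i ∩ B j).indicator (fun _ => (1:ℝ)) x) ≤
      (⋃ i ∈ s, B i).indicator (fun _ => (1:ℝ)) x := by
    intro x
    have hW : (∑ i ∈ s, ∑ j ∈ s, (B i ∩ B j).indicator (fun _ => (1:ℝ)) x) =
      (∑ i ∈ s, (B i).indicator (fun _ => (1:ℝ)) x) ^ 2 := by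
      rw [sq, Finset.sum_mul_sum]
      refine Finset.sum_congr rfl fun i _ => Finset.sum_congr rfl fun j _ => ?_
      by_cases hi : x ∈ B i <;> by_cases hj : x ∈ B j <;> simp [hi, hj]
    rw [hW]
    by_cases hx : x ∈ ⋃ i ∈ s, B i
    · rw [Set.indicator_of_mem hx]
      nlinarith [sq_nonneg (1 - l * ∑ i ∈ s, (B i).indicator (fun _ => (1:ℝ)) x)]
    · rw [Set.indicator_of_notMem hx, Finset.sum_eq_zero]
      · simp
      · intro i hi
        refine Set.indicator_of_notMem (fun h => hx ?_) _
        exact Set.mem_biUnion (Finset.mem_coe.2 hi) h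
  have hU : MeasurableSet (⋃ i ∈ s, B i) := Finset.measurableSet_biUnion _ fun i _ => hB i
  have hI : ∀ E : Set Ω, MeasurableSet E → Integrable (E.indicator (fun _ => (1:ℝ))) μ :=
    fun E hE => (integrable_const 1).indicator hE
  have hE1 : ∀ E : Set Ω, MeasurableSet E → ∫ x, E.indicator (fun _ => (1:ℝ)) x ∂μ = μ.real E :=
    fun E hE => by rw [integral_indicator hE]; simp
  have i1 : Integrable (fun x => ∑ i ∈ s, (B i).indicator (fun _ => (1:ℝ)) x) μ :=
    integrable_finsetSum _ fun i _ => hI _ (hB i)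
  have i2 : Integrable (fun x => ∑ i ∈ s, ∑ j ∈ s, (B i ∩ B j).indicator (fun _ => (1:ℝ)) x) μ :=
    integrable_finsetSum _ fun i _ => integrable_finsetSum _ fun j _ => hI _ ((hB i).inter (hB j))
  have h := integral_mono ((i1.const_mul (2 * l)).sub (i2.const_mul (l ^ 2))) (hI _ hU) key
  rw [hE1 _ hU] at h
  simp only [Pi.sub_apply] at h
  rw [integral_sub (i1.const_mul (2 * l)) (i2.const_mul (l ^ 2)), integral_const_mul, integral_const_mul,
    integral_finsetSum _ (fun i _ => hI _ (hB i)),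
    integral_finsetSum _ (fun i _ => integrable_finsetSum _ fun j _ => hI _ ((hB i).inter (hB j)))] at h
  have e2 : ∑ i ∈ s, ∫ x, ∑ j ∈ s, (B i ∩ B j).indicator (fun _ => (1:ℝ)) x ∂μ =
      ∑ i ∈ s, ∑ j ∈ s, μ.real (B i ∩ B j) := by
    refine Finset.sum_congr rfl fun i _ => ?_
    rw [integral_finsetSum _ fun j _ => hI _ ((hB i).inter (hB j))]
    exact Finset.sum_congr rfl fun j _ => hE1 _ ((hB i).inter (hB j))
  rw [e2, Finset.sum_congr rfl fun i _ => hE1 _ (hB i)] at h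
  have a1 : s.card * p ≤ ∑ i ∈ s, μ.real (B i) := by
    have := Finset.sum_le_sum h1
    simpa using this
  have a2 : ∑ i ∈ s, ∑ j ∈ s, μ.real (B i ∩ B j) ≤ s.card * q := by
    have := Finset.sum_le_sum h2
    simpa using this
  calc s.card * p ^ 2 / q = 2 * l * (s.card * p) - l ^ 2 * (s.card * q) := by
        simp only [l]; field_simp; ring
    _ ≤ _ := by
        refine le_trans ?_ h
        gcongr

lemma single_lower {n N : ℕ} (hn : 0 < n) {t : ℝ} (ht : 0 < t)
    {S : Finset (Fin N) × Finset (Fin N)} (hS : S ∈ Sfam n N) :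
    Real.exp (-(t ^ 2 / 2) - 4 * t - 6) / 2 ≤ (PTheta N 0).real (scan1 n N t S) := by
  have hn' : (0:ℝ) < n := by exact_mod_cast hn
  set c := ((t + 2) / n) • ind S.1 S.2 with hc
  have hcc : ip c c = (t + 2) ^ 2 := by
    rw [hc, ip_smul_smul, ip_ind_self hS]; field_simp
  have hic : ip (ind S.1 S.2) c = n * (t + 2) := by
    rw [ip_comm, hc, ip_smul_left, ip_ind_self hS]; field_simp
  set G : Set (Fin N → Fin N → ℝ) := {x | ip (ind S.1 S.2) x < n * t}
  set H : Set (Fin N → Fin N → ℝ) := {x | n * (t + 4) < ip (ind S.1 S.2) x}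
  have hG : MeasurableSet G := measurableSet_lt (ip_measurable _) measurable_const
  have hH : MeasurableSet H := measurableSet_lt measurable_const (ip_measurable _)
  have g1 : (PTheta N c).real G ≤ Real.exp (-2) := by
    have h := chernoff c ((-(2 / n) : ℝ) • ind S.1 S.2) G hG 4 ?_
    · rw [ip_smul_smul, ip_ind_self hS] at h
      refine h.trans (le_of_eq ?_)
      congr 1
      field_simp
      norm_num
    · intro x hx
      have hx' : ip (ind S.1 S.2) x < n * t := hx
      rw [ip_smul_left, ip_sub, hic]
      calc (4:ℝ) = 2 / n * (n * (t + 2) - n * t) := by field_simp; ring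
        _ ≤ 2 / n * (n * (t + 2) - ip (ind S.1 S.2) x) := by gcongr
        _ = _ := by ring
  have h1 : (PTheta N c).real H ≤ Real.exp (-2) := by
    have h := chernoff c ((2 / n : ℝ) • ind S.1 S.2) H hH 4 ?_
    · rw [ip_smul_smul, ip_ind_self hS] at h
      refine h.trans (le_of_eq ?_)
      congr 1
      field_simp
      norm_num
    · intro x hx
      have hx' : n * (t + 4) < ip (ind S.1 S.2) x := hx
      rw [ip_smul_left, ip_sub, hic]
      calc (4:ℝ) = 2 / n * (n * (t + 4) - n * (t + 2)) := by field_simp; ring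
        _ ≤ _ := by gcongr
  have hexp : Real.exp (-2) ≤ 1 / 4 := by
    rw [Real.exp_neg, ← one_div]
    apply one_div_le_one_div_of_le (by norm_num)
    have := Real.add_one_le_exp (1:ℝ)
    have e : Real.exp 2 = Real.exp 1 * Real.exp 1 := by rw [← Real.exp_add]; norm_num
    rw [e]; nlinarith
  have hF : 1 / 2 ≤ (PTheta N c).real (G ∪ H)ᶜ := by
    rw [probReal_compl_eq_one_sub (hG.union hH)]
    have := measureReal_union_le (μ := PTheta N c) G H
    linarith
  have h2 := shift_le 0 c (G ∪ H)ᶜ (hG.union hH).compl ((t + 2) * (t + 4)) (by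
    intro x hx
    have hx' : ip (ind S.1 S.2) x ≤ n * (t + 4) := by
      simp [G, H] at hx
      exact hx.2
    rw [sub_zero, hc, ip_smul_left]
    calc (t + 2) / n * ip (ind S.1 S.2) x ≤ (t + 2) / n * (n * (t + 4)) := by gcongr
      _ = _ := by field_simp)
  rw [zero_add, hcc] at h2
  have h3 : (PTheta N 0).real (G ∪ H)ᶜ ≤ (PTheta N 0).real (scan1 n N t S) := by
    refine measureReal_mono ?_
    intro x hx
    simp [G, H] at hx
    exact hx.1
  have h4 : 1 / 2 ≤ Real.exp (-(-(t ^ 2 / 2) - 4 * t - 6)) * (PTheta N 0).real (scan1 n N t S) := by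
    refine hF.trans (h2.trans ?_)
    rw [show (t + 2) * (t + 4) - (t + 2) ^ 2 / 2 = -(-(t ^ 2 / 2) - 4 * t - 6) by ring]
    gcongr
  rw [Real.exp_neg, inv_mul_eq_div, le_div_iff₀ (Real.exp_pos _)] at h4
  linarith

lemma pair_upper {n N : ℕ} (hn : 0 < n) {t : ℝ} (ht : 0 < t)
    {S S' : Finset (Fin N) × Finset (Fin N)} (hS : S ∈ Sfam n N) (hS' : S' ∈ Sfam n N) :
    (PTheta N 0).real (scan1 n N t S ∩ scan1 n N t S') ≤
      Real.exp (-((n * t) ^ 2 / (n ^ 2 + (S.1 ∩ S'.1).card * (S.2 ∩ S'.2).card))) := by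
  have hn' : (0:ℝ) < n := by exact_mod_cast hn
  set r : ℝ := (S.1 ∩ S'.1).card * (S.2 ∩ S'.2).card
  have hr : 0 ≤ r := by positivity
  have h := chernoff 0 ((n * t / (n ^ 2 + r)) • (ind S.1 S.2 + ind S'.1 S'.2))
    (scan1 n N t S ∩ scan1 n N t S') ((scan1_meas _ _ _ _).inter (scan1_meas _ _ _ _))
    (2 * (n * t) ^ 2 / (n ^ 2 + r)) ?_
  · have e : ip (ind S.1 S.2 + ind S'.1 S'.2) (ind S.1 S.2 + ind S'.1 S'.2) = 2 * (n ^ 2 + r) := by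
      rw [ip_add_left, ip_comm, ip_add_left, ip_ind_self hS, ip_comm (ind S'.1 S'.2) (_ + _),
        ip_add_left, ip_ind_self hS', ip_comm (ind S'.1 S'.2), ip_ind_ind]
      ring
    rw [ip_smul_smul, e] at h
    refine h.trans (le_of_eq ?_)
    congr 1
    field_simp
    ring
  · rintro x ⟨hx, hx'⟩
    have hx : n * t ≤ ip (ind S.1 S.2) x := hx
    have hx' : n * t ≤ ip (ind S'.1 S'.2) x := hx'
    rw [sub_zero, ip_smul_left, ip_add_left]
    calc 2 * (n * t) ^ 2 / (n ^ 2 + r) = n * t / (n ^ 2 + r) * (n * t + n * t) := by ring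
      _ ≤ _ := by gcongr

lemma bayes_lower {n N : ℕ} (hnN : n ≤ N) {t A : ℝ} (hA : 0 ≤ A) {g : ℝ} (hg0 : 0 ≤ g)
    (hg1 : g ≤ 1) (hg : g * (N.choose n : ℝ) ^ 2 ≤ Real.exp (A * n * t - (A * n) ^ 2 / 2)) :
    g * (PTheta N 0).real (scanE n N t) ≤ minimaxRisk n N A := by
  have : Nonempty {T : Set (Fin N → Fin N → ℝ) // MeasurableSet T} := ⟨⟨∅, MeasurableSet.empty⟩⟩
  refine le_ciInf ?_
  rintro ⟨T, hT⟩
  have hM : (0:ℝ) < (N.choose n : ℝ) := by exact_mod_cast Nat.choose_pos hnN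
  set e := Real.exp (A * n * t - (A * n) ^ 2 / 2)
  set b := ⨆ θ : ThetaSet A n N, (PTheta N θ.1 Tᶜ).toReal with hb
  have hbdd : BddAbove (Set.range fun θ : ThetaSet A n N => (PTheta N θ.1 Tᶜ).toReal) := by
    refine ⟨1, ?_⟩
    rintro _ ⟨θ, rfl⟩
    exact measureReal_le_one (μ := PTheta N θ.1) (s := Tᶜ)
  have h1 : ∀ S ∈ Sfam n N, e * (PTheta N 0).real (Tᶜ ∩ scan1 n N t S) ≤ b := by
    intro S hS
    have hθ : A • ind S.1 S.2 ∈ ThetaSet A n N := by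
      refine ⟨S.1, S.2, (mem_Sfam.1 hS).1, (mem_Sfam.1 hS).2, ?_, ?_⟩
      · intro i j hi hj
        simp [ind, hi, hj]
      · intro i j hij
        simp only [Pi.smul_apply, ind, if_neg hij, smul_zero]
    have h := shift_ge 0 (A • ind S.1 S.2) (Tᶜ ∩ scan1 n N t S) (hT.compl.inter (scan1_meas _ _ _ _))
      (A * n * t) (by
        rintro x ⟨-, hx⟩
        have hx : n * t ≤ ip (ind S.1 S.2) x := hx
        rw [sub_zero, ip_smul_left, mul_assoc]
        gcongr)
    rw [zero_add, ip_smul_smul, ip_ind_self hS, ← mul_pow] at h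
    refine h.trans ((measureReal_mono Set.inter_subset_left).trans ?_)
    exact le_ciSup hbdd (⟨_, hθ⟩ : ThetaSet A n N)
  have h2 : e * (PTheta N 0).real (Tᶜ ∩ scanE n N t) ≤ (N.choose n : ℝ) ^ 2 * b := by
    have := Finset.sum_le_sum h1
    rw [Finset.sum_const, card_Sfam, nsmul_eq_mul, ← Finset.mul_sum] at this
    push_cast at this
    refine le_trans ?_ this
    refine mul_le_mul_of_nonneg_left ?_ (Real.exp_pos _).le
    rw [scanE, Set.inter_iUnion₂]
    exact measureReal_biUnion_finset_le _ _
  have h3 : g * (PTheta N 0).real (Tᶜ ∩ scanE n N t) ≤ b := by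
    have h4 : (N.choose n : ℝ) ^ 2 * (g * (PTheta N 0).real (Tᶜ ∩ scanE n N t)) ≤
        (N.choose n : ℝ) ^ 2 * b := by
      refine le_trans ?_ h2
      rw [← mul_assoc, mul_comm _ g]
      exact mul_le_mul_of_nonneg_right hg measureReal_nonneg
    exact le_of_mul_le_mul_left h4 (by positivity)
  have h5 : (PTheta N 0).real (scanE n N t) ≤
      (PTheta N 0).real T + (PTheta N 0).real (Tᶜ ∩ scanE n N t) := by
    refine (measureReal_mono ?_).trans (measureReal_union_le _ _)
    intro x hx
    by_cases hxT : x ∈ T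
    · exact Or.inl hxT
    · exact Or.inr ⟨hxT, hx⟩
  have h6 : g * (PTheta N 0).real T ≤ (PTheta N 0).real T :=
    mul_le_of_le_one_left measureReal_nonneg hg1
  have h7 := mul_le_mul_of_nonneg_left h5 hg0
  change _ ≤ (PTheta N 0).real T + b
  linarith

lemma weight_sum {n N : ℕ} (w : Fin N → ℝ) (hw : ∀ i, 0 ≤ w i) :
    ∑ R ∈ Finset.powersetCard n (Finset.univ : Finset (Fin N)), ∏ i ∈ R, w i ≤
      Real.exp (∑ i, w i) := by
  refine le_trans ?_ (Real.prod_one_add_le_exp_sum Finset.univ hw)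
  rw [Finset.prod_one_add]
  refine Finset.sum_le_sum_of_subset_of_nonneg ?_ fun R _ _ => Finset.prod_nonneg fun i _ => hw i
  intro R hR
  rw [Finset.mem_powerset]
  exact Finset.subset_univ R

lemma overlap_sum {n N : ℕ} {β : ℝ} (hβ : Real.exp (-β) * N ≤ n)
    (R : Finset (Fin N)) (hR : R.card = n) :
    ∑ R' ∈ Finset.powersetCard n (Finset.univ : Finset (Fin N)),
      Real.exp (-(β * (n - (R ∩ R').card))) ≤ Real.exp (2 * n) := by
  have h := weight_sum (n := n) (N := N) (fun i => if i ∈ R then 1 else Real.exp (-β))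
    (fun i => by split_ifs <;> positivity)
  have e1 : ∑ i, (if i ∈ R then (1:ℝ) else Real.exp (-β)) ≤ 2 * n := by
    calc ∑ i, (if i ∈ R then (1:ℝ) else Real.exp (-β))
        ≤ ∑ i, ((if i ∈ R then (1:ℝ) else 0) + Real.exp (-β)) := by
          refine Finset.sum_le_sum fun i _ => ?_
          have := Real.exp_pos (-β)
          split_ifs <;> linarith
      _ = n + Real.exp (-β) * N := by
          rw [Finset.sum_add_distrib]
          simp [hR, mul_comm]
      _ ≤ _ := by linarith
  refine le_trans (le_of_eq ?_) (h.trans (Real.exp_le_exp.2 e1))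
  refine Finset.sum_congr rfl fun R' hR' => ?_
  rw [Finset.mem_powersetCard] at hR'
  rw [Finset.prod_ite, Finset.prod_const_one, one_mul, Finset.prod_const, ← Real.exp_nat_mul]
  congr 1
  have h1 : (R' \ R).card + (R' ∩ R).card = R'.card := Finset.card_sdiff_add_card_inter R' R
  have h2 : R'.filter (fun x => x ∉ R) = R' \ R := by
    ext; simp
  rw [h2, Finset.inter_comm R R']
  rw [hR'.2] at h1
  have h3 : ((R' \ R).card : ℝ) + (R' ∩ R).card = n := by exact_mod_cast h1
  rw [← h3]
  ring

lemma choose_upper {n N : ℕ} {β : ℝ} (hβ : Real.exp (-β) * N ≤ n) :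
    (N.choose n : ℝ) ≤ Real.exp (n * β + n) := by
  have h := weight_sum (n := n) (N := N) (fun i => Real.exp (-β)) (fun i => by positivity)
  have e : ∑ R ∈ Finset.powersetCard n (Finset.univ : Finset (Fin N)), ∏ i ∈ R, Real.exp (-β) =
      N.choose n * Real.exp (-(n * β)) := by
    rw [Finset.sum_congr rfl (g := fun _ => Real.exp (-(n * β)))]
    · simp
    · intro R hR
      rw [Finset.mem_powersetCard] at hR
      rw [Finset.prod_const, hR.2, ← Real.exp_nat_mul]
      congr 1
      ring
  rw [e] at h
  have h2 : Real.exp (∑ i : Fin N, Real.exp (-β)) ≤ Real.exp n := by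
    apply Real.exp_le_exp.2
    simpa [mul_comm] using hβ
  have h3 := h.trans h2
  rw [Real.exp_neg, ← div_eq_mul_inv, div_le_iff₀ (Real.exp_pos _), ← Real.exp_add] at h3
  rwa [add_comm]

lemma exponent_ineq {n a b t β : ℝ} (hn : 0 < n) (ha : 0 ≤ a) (hb : 0 ≤ b) (han : a ≤ n) (hbn : b ≤ n)
    (hβ : 0 ≤ β) (ht : 2 * n * β ≤ t ^ 2 / 2) :
    t ^ 2 / 2 + β * (n - a) + β * (n - b) ≤ (n * t) ^ 2 / (n ^ 2 + a * b) := by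
  have hab : 0 ≤ a * b := mul_nonneg ha hb
  have hle : a * b ≤ n ^ 2 := by nlinarith
  rw [le_div_iff₀ (by positivity)]
  have h1 : β * (2 * n - a - b) * (n ^ 2 + a * b) ≤ β * (2 * n * (n ^ 2 - a * b)) := by
    rw [mul_assoc]
    refine mul_le_mul_of_nonneg_left ?_ hβ
    nlinarith [mul_nonneg ha (sq_nonneg (n - b)), mul_nonneg hb (sq_nonneg (n - a))]
  have h2 : 2 * n * β * (n ^ 2 - a * b) ≤ t ^ 2 / 2 * (n ^ 2 - a * b) :=
    mul_le_mul_of_nonneg_right ht (by linarith)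
  nlinarith

lemma overlap_total {n N : ℕ} (hn : 0 < n) {t β : ℝ} (ht : 0 < t) (hβ0 : 0 ≤ β)
    (hβ : Real.exp (-β) * N ≤ n) (htβ : 2 * n * β ≤ t ^ 2 / 2)
    {S : Finset (Fin N) × Finset (Fin N)} (hS : S ∈ Sfam n N) :
    ∑ S' ∈ Sfam n N, (PTheta N 0).real (scan1 n N t S ∩ scan1 n N t S') ≤
      Real.exp (-(t ^ 2 / 2) + 4 * n) := by
  have hn' : (0:ℝ) < n := by exact_mod_cast hn
  have hS1 := mem_Sfam.1 hS
  have h1 : ∀ S' ∈ Sfam n N, (PTheta N 0).real (scan1 n N t S ∩ scan1 n N t S') ≤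
      Real.exp (-(t ^ 2 / 2)) * (Real.exp (-(β * (n - (S.1 ∩ S'.1).card))) *
        Real.exp (-(β * (n - (S.2 ∩ S'.2).card)))) := by
    intro S' hS'
    refine (pair_upper hn ht hS hS').trans ?_
    rw [← Real.exp_add, ← Real.exp_add, Real.exp_le_exp]
    have c1 : ((S.1 ∩ S'.1).card : ℝ) ≤ n := by
      exact_mod_cast (Finset.card_le_card Finset.inter_subset_left).trans hS1.1.le
    have c2 : ((S.2 ∩ S'.2).card : ℝ) ≤ n := by
      exact_mod_cast (Finset.card_le_card Finset.inter_subset_left).trans hS1.2.le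
    have := exponent_ineq hn' (Nat.cast_nonneg _) (Nat.cast_nonneg _) c1 c2 hβ0 htβ
    linarith
  refine (Finset.sum_le_sum h1).trans ?_
  rw [← Finset.mul_sum, Sfam, Finset.sum_product]
  simp only [← Finset.mul_sum, ← Finset.sum_mul]
  rw [Real.exp_add, show (4 * n : ℝ) = 2 * n + 2 * n by ring, Real.exp_add (2 * (n:ℝ))]
  gcongr
  · exact overlap_sum hβ S.1 hS1.1
  · exact overlap_sum hβ S.2 hS1.2

lemma risk_lower {n N : ℕ} (hn : 0 < n) (hnN : n ≤ N) {t A β : ℝ} (ht : 0 < t) (hA : 0 ≤ A)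
    (hβ0 : 0 ≤ β) (hβ : Real.exp (-β) * N ≤ n) (htβ : 2 * n * β ≤ t ^ 2 / 2)
    (hAt : A * n * t - (A * n) ^ 2 / 2 = 2 * n * β)
    (hM : Real.exp (2 * n * β - 4 * n) ≤ (N.choose n : ℝ) ^ 2) :
    Real.exp (2 * n * β - t ^ 2 / 2 - 10 * n - 8 * t - 12) / 4 ≤ minimaxRisk n N A := by
  have hup := choose_upper hβ
  have h := bayes_lower (t := t) hnN hA (g := Real.exp (-(2 * n))) (Real.exp_pos _).le
    (Real.exp_le_one_iff.2 (by simp)) (by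
      rw [hAt]
      calc Real.exp (-(2 * n)) * (N.choose n : ℝ) ^ 2
          ≤ Real.exp (-(2 * n)) * (Real.exp (n * β + n)) ^ 2 := by gcongr
        _ = _ := by
          rw [← Real.exp_nat_mul, ← Real.exp_add]
          congr 1
          push_cast
          ring)
  refine le_trans ?_ h
  have h2 := second_moment (PTheta N 0) (Sfam n N) (scan1 n N t) (scan1_meas n N t)
    (Real.exp (-(t ^ 2 / 2) - 4 * t - 6) / 2) (Real.exp (-(t ^ 2 / 2) + 4 * n)) (by positivity)
    (Real.exp_pos _) (fun S hS => single_lower hn ht hS)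
    (fun S hS => overlap_total hn ht hβ0 hβ htβ hS)
  rw [card_Sfam] at h2
  push_cast at h2
  calc Real.exp (2 * n * β - t ^ 2 / 2 - 10 * n - 8 * t - 12) / 4
      = Real.exp (-(2 * n)) * (Real.exp (2 * n * β - 4 * n) *
        (Real.exp (-(t ^ 2 / 2) - 4 * t - 6) / 2) ^ 2 / Real.exp (-(t ^ 2 / 2) + 4 * n)) := by
        rw [div_pow, ← Real.exp_nat_mul, mul_div_assoc, div_right_comm, ← Real.exp_sub, ← mul_div_assoc,
          ← mul_div_assoc, ← Real.exp_add, ← Real.exp_add]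
        norm_num
        ring
    _ ≤ Real.exp (-(2 * n)) * ((N.choose n : ℝ) ^ 2 *
        (Real.exp (-(t ^ 2 / 2) - 4 * t - 6) / 2) ^ 2 / Real.exp (-(t ^ 2 / 2) + 4 * n)) := by
        gcongr
    _ ≤ _ := by
        refine mul_le_mul_of_nonneg_left ?_ (Real.exp_pos _).le
        exact h2

lemma choose_lower {n N : ℕ} (hn : 0 < n) (hnN : n ≤ N) {β : ℝ}
    (h : n * Real.exp β / 2 ≤ (N : ℝ) + 1 - n) :
    Real.exp (2 * n * β - 4 * n) ≤ (N.choose n : ℝ) ^ 2 := by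
  have hn' : (0:ℝ) < n := by exact_mod_cast hn
  have h1 : Real.exp (n * β - 2 * n) ≤ N.choose n := by
    refine le_trans ?_ (Nat.pow_le_choose (α := ℝ) n N)
    rw [le_div_iff₀ (by exact_mod_cast Nat.factorial_pos n)]
    have hf : (n.factorial : ℝ) ≤ (n : ℝ) ^ n := by exact_mod_cast Nat.factorial_le_pow n
    have e2 : Real.exp (β - 2) ≤ Real.exp β / 2 := by
      rw [Real.exp_sub]
      have := Real.add_one_le_exp (2:ℝ)
      gcongr
      linarith
    rw [Nat.cast_sub (by omega)]
    push_cast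
    calc Real.exp (n * β - 2 * n) * n.factorial ≤ Real.exp (β - 2) ^ n * (n : ℝ) ^ n := by
          rw [← Real.exp_nat_mul, show (n : ℝ) * (β - 2) = n * β - 2 * n by ring]
          gcongr
      _ = (Real.exp (β - 2) * n) ^ n := by rw [mul_pow]
      _ ≤ ((N : ℝ) + 1 - n) ^ n := by
          gcongr
          refine le_trans ?_ h
          calc Real.exp (β - 2) * n ≤ Real.exp β / 2 * n := by gcongr
            _ = _ := by ring
  calc Real.exp (2 * n * β - 4 * n) = Real.exp (n * β - 2 * n) ^ 2 := by
        rw [← Real.exp_nat_mul]; congr 1; push_cast; ring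
    _ ≤ _ := by gcongr

lemma main_bounds (α δ : ℝ) (hα : 0 < α) (hδ : 0 < δ) (n : ℕ) (hn : 2 ≤ n)
    (h4 : 4 ≤ (n : ℝ) ^ α) (L κ s : ℝ) (hL : L = 2 * n * (α * Real.log n))
    (hκ : κ = δ ^ 2 / (4 * (1 + δ))) (hs : s = (2 + δ) / Real.sqrt (2 * (1 + δ))) :
    let N := ⌊(n : ℝ) ^ (1 + α)⌋₊
    let lR := Real.log (minimaxRisk n N (Real.sqrt (4 * (1 + δ) * α * Real.log n / n)))
    let lS := Real.log ((N.choose n : ℝ) ^ 2)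
    (-κ * L - 10 * n - 8 * (s * Real.sqrt L) - 12 - Real.log 4 ≤ lR) ∧
    (lR ≤ -κ * L + 2 * n + Real.log 2) ∧ (L - 4 * n ≤ lS) ∧ (lS ≤ L + 2 * n) := by
  intro N lR lS
  have hn0 : 0 < n := by omega
  have hn' : (0:ℝ) < n := by exact_mod_cast hn0
  have hn1 : (1:ℝ) < n := by exact_mod_cast hn
  have hlog : 0 < Real.log n := Real.log_pos hn1
  set β := α * Real.log n with hβdef
  have hβpos : 0 < β := by positivity
  have hLpos : 0 < L := by rw [hL]; positivity
  have hexpβ : Real.exp β = (n : ℝ) ^ α := by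
    rw [Real.rpow_def_of_pos hn', mul_comm]
  have hpow : (n : ℝ) ^ (1 + α) = n * Real.exp β := by
    rw [Real.rpow_add hn', Real.rpow_one, hexpβ]
  have hNle : (N : ℝ) ≤ n * Real.exp β := by
    rw [← hpow]; exact Nat.floor_le (by positivity)
  have hNgt : n * Real.exp β < (N : ℝ) + 1 := by
    rw [← hpow]; exact Nat.lt_floor_add_one _
  have h4' : 4 ≤ Real.exp β := by rw [hexpβ]; exact h4
  have hnexp : (n:ℝ) * 4 ≤ n * Real.exp β := by gcongr
  have hnN : n ≤ N := by
    have : (n : ℝ) < N + 1 := by linarith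
    have : n < N + 1 := by exact_mod_cast this
    omega
  have hβN : Real.exp (-β) * N ≤ n := by
    rw [Real.exp_neg, inv_mul_le_iff₀ (Real.exp_pos _), mul_comm]
    exact hNle
  have hMlow := choose_lower hn0 hnN (β := β) (by linarith)
  have hMup : (N.choose n : ℝ) ^ 2 ≤ Real.exp (L + 2 * n) := by
    calc (N.choose n : ℝ) ^ 2 ≤ (Real.exp (n * β + n)) ^ 2 := by
          gcongr
          exact choose_upper hβN
      _ = _ := by
          rw [← Real.exp_nat_mul, hL]; congr 1; push_cast; ring
  set w := Real.sqrt (2 * (1 + δ)) with hw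
  have hwpos : 0 < w := by positivity
  have hw2 : w ^ 2 = 2 * (1 + δ) := Real.sq_sqrt (by positivity)
  set l := Real.sqrt L with hl
  have hlpos : 0 < l := Real.sqrt_pos.2 hLpos
  have hl2 : l ^ 2 = L := Real.sq_sqrt hLpos.le
  set A := Real.sqrt (4 * (1 + δ) * α * Real.log n / n) with hAdef
  have hA0 : 0 ≤ A := Real.sqrt_nonneg _
  have hAn : A * n = w * l := by
    rw [← sq_eq_sq₀ (by positivity) (by positivity), mul_pow, mul_pow, hw2, hl2, hAdef,
      Real.sq_sqrt (by positivity), hL, hβdef]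
    field_simp
    ring
  have hspos : 0 < s := by rw [hs]; positivity
  have hsw : s * w = 2 + δ := by rw [hs]; field_simp
  have hs2 : s ^ 2 = (2 + δ) ^ 2 / (2 * (1 + δ)) := by rw [hs, div_pow, hw2]
  have hκs : s ^ 2 / 2 = 1 + κ := by
    rw [hs2, hκ]; field_simp; ring
  have hκpos : 0 < κ := by rw [hκ]; positivity
  set t := s * l with ht
  have htpos : 0 < t := by positivity
  have ht2 : t ^ 2 / 2 = L + κ * L := by
    rw [ht, mul_pow, hl2, mul_div_right_comm, hκs]; ring
  have hdiff : (A * n - t) ^ 2 / 2 = κ * L := by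
    have : (A * n - t) ^ 2 / 2 = (w ^ 2 - 2 * (s * w) + s ^ 2) / 2 * l ^ 2 := by
      rw [hAn, ht]; ring
    rw [this, hw2, hsw, hs2, hl2, hκ]
    field_simp
    ring
  have htA : t ≤ A * n := by
    rw [hAn, ht]
    refine mul_le_mul_of_nonneg_right ?_ hlpos.le
    rw [hs, div_le_iff₀ hwpos, ← sq, hw2]
    linarith
  have hup := risk_upper (N := N) hn0 htpos htA
  have hlow := risk_lower hn0 hnN htpos hA0 hβpos.le hβN (by rw [ht2, ← hL]; nlinarith)
    (by
      have e : A * n * t - (A * n) ^ 2 / 2 = (s * w - w ^ 2 / 2) * l ^ 2 := by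
        rw [hAn, ht]; ring
      rw [e, hsw, hw2, hl2, ← hL]; ring) hMlow
  have hRpos : 0 < minimaxRisk n N A := lt_of_lt_of_le (by positivity) hlow
  have hSpos : (0:ℝ) < (N.choose n : ℝ) ^ 2 := lt_of_lt_of_le (Real.exp_pos _) hMlow
  refine ⟨?_, ?_, ?_, ?_⟩
  · have h := Real.log_le_log (by positivity) hlow
    rw [Real.log_div (Real.exp_pos _).ne' (by norm_num), Real.log_exp, ht2, ← hL] at h
    linarith
  · rw [ht2, hdiff] at hup
    have h : minimaxRisk n N A ≤ 2 * Real.exp (-κ * L + 2 * n) := by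
      refine hup.trans ?_
      have a1 : (N.choose n : ℝ) ^ 2 * Real.exp (-(L + κ * L)) ≤ Real.exp (-κ * L + 2 * n) := by
        calc (N.choose n : ℝ) ^ 2 * Real.exp (-(L + κ * L))
            ≤ Real.exp (L + 2 * n) * Real.exp (-(L + κ * L)) := by gcongr
          _ = _ := by rw [← Real.exp_add]; congr 1; ring
      have a2 : Real.exp (-(κ * L)) ≤ Real.exp (-κ * L + 2 * n) := by
        apply Real.exp_le_exp.2
        linarith
      linarith
    have h' := Real.log_le_log hRpos h
    rw [Real.log_mul (by norm_num) (Real.exp_pos _).ne', Real.log_exp] at h'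
    linarith
  · have h := Real.log_le_log (Real.exp_pos _) hMlow
    rw [Real.log_exp, ← hL] at h
    exact h
  · have h := Real.log_le_log hSpos hMup
    rw [Real.log_exp] at h
    exact h

/-- **Sparse above-boundary regime, part 1.**  For fixed α > 0 and δ > 0, with
`A(n) = √(4(1+δ)α log n / n)` and `N = ⌊n^{1+α}⌋`, the minimax risk satisfies
`log R_n(A(n)) / log |S| → -δ²/(4(1+δ))`, where `|S| = C(N,n)²`. -/
theorem sparse_above_boundary (α δ : ℝ) (hα : 0 < α) (hδ : 0 < δ) :
    Tendsto (fun n : ℕ =>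
        Real.log (minimaxRisk n ⌊(n : ℝ) ^ (1 + α)⌋₊
            (Real.sqrt (4 * (1 + δ) * α * Real.log n / n))) /
          Real.log (((⌊(n : ℝ) ^ (1 + α)⌋₊.choose n : ℝ)) ^ 2))
      atTop (𝓝 (-(δ ^ 2) / (4 * (1 + δ)))) := by
  set κ := δ ^ 2 / (4 * (1 + δ)) with hκ
  set s := (2 + δ) / Real.sqrt (2 * (1 + δ)) with hs
  set L : ℕ → ℝ := fun n => 2 * n * (α * Real.log n) with hL
  have hcast : Tendsto (fun n : ℕ => (n : ℝ)) atTop atTop := tendsto_natCast_atTop_atTop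
  have hlogT : Tendsto (fun n : ℕ => Real.log n) atTop atTop := Real.tendsto_log_atTop.comp hcast
  have hLT : Tendsto L atTop atTop := by
    refine Tendsto.atTop_mul_atTop₀ (hcast.const_mul_atTop two_pos) (hlogT.const_mul_atTop hα)
  have hev : ∀ᶠ n : ℕ in atTop, 2 ≤ n ∧ 4 ≤ (n : ℝ) ^ α :=
    (eventually_ge_atTop 2).and (((tendsto_rpow_atTop hα).comp hcast).eventually_ge_atTop 4)
  have hLpos : ∀ᶠ n : ℕ in atTop, 0 < L n := hLT.eventually_gt_atTop 0
  have d1 : Tendsto (fun n : ℕ => (n : ℝ) / L n) atTop (𝓝 0) := by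
    have h : Tendsto (fun n : ℕ => (2 * (α * Real.log n))⁻¹) atTop (𝓝 0) :=
      ((hlogT.const_mul_atTop hα).const_mul_atTop two_pos).inv_tendsto_atTop
    refine h.congr' ?_
    filter_upwards [hev] with n hn
    have hn' : (0:ℝ) < n := by exact_mod_cast (by omega : 0 < n)
    simp only [hL]
    rw [eq_div_iff, ← div_eq_inv_mul]
    · have : Real.log n ≠ 0 := (Real.log_pos (by exact_mod_cast (by omega : 1 < n))).ne'
      field_simp
    · have : Real.log n ≠ 0 := (Real.log_pos (by exact_mod_cast (by omega : 1 < n))).ne'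
      positivity
  have d2 : Tendsto (fun n : ℕ => Real.sqrt (L n) / L n) atTop (𝓝 0) := by
    have h : Tendsto (fun n : ℕ => (Real.sqrt (L n))⁻¹) atTop (𝓝 0) :=
      (Real.tendsto_sqrt_atTop.comp hLT).inv_tendsto_atTop
    refine h.congr fun n => ?_
    rw [Real.sqrt_div_self', one_div]
  have d3 : Tendsto (fun n : ℕ => (L n)⁻¹) atTop (𝓝 0) := hLT.inv_tendsto_atTop
  have hR : Tendsto (fun n : ℕ => Real.log (minimaxRisk n ⌊(n : ℝ) ^ (1 + α)⌋₊
      (Real.sqrt (4 * (1 + δ) * α * Real.log n / n))) / L n) atTop (𝓝 (-κ)) := by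
    have lo : Tendsto (fun n : ℕ => -κ - 10 * ((n : ℝ) / L n) - 8 * s * (Real.sqrt (L n) / L n)
        - (12 + Real.log 4) * (L n)⁻¹) atTop (𝓝 (-κ)) := by
      have := ((tendsto_const_nhds (x := -κ)).sub (d1.const_mul 10)).sub (d2.const_mul (8 * s))
        |>.sub (d3.const_mul (12 + Real.log 4))
      simpa using this
    have hi : Tendsto (fun n : ℕ => -κ + 2 * ((n : ℝ) / L n) + Real.log 2 * (L n)⁻¹)
        atTop (𝓝 (-κ)) := by
      have := ((tendsto_const_nhds (x := -κ)).add (d1.const_mul 2)).add (d3.const_mul (Real.log 2))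
      simpa using this
    refine tendsto_of_tendsto_of_tendsto_of_le_of_le' lo hi ?_ ?_
    · filter_upwards [hev, hLpos] with n hn hp
      obtain ⟨h1, h2, h3, h4⟩ := main_bounds α δ hα hδ n hn.1 hn.2 (L n) κ s rfl hκ hs
      rw [le_div_iff₀ hp]
      refine le_trans (le_of_eq ?_) h1
      field_simp
      ring
    · filter_upwards [hev, hLpos] with n hn hp
      obtain ⟨h1, h2, h3, h4⟩ := main_bounds α δ hα hδ n hn.1 hn.2 (L n) κ s rfl hκ hs
      rw [div_le_iff₀ hp]
      refine h2.trans (le_of_eq ?_)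
      field_simp
  have hS : Tendsto (fun n : ℕ =>
      Real.log (((⌊(n : ℝ) ^ (1 + α)⌋₊.choose n : ℝ)) ^ 2) / L n) atTop (𝓝 1) := by
    have lo : Tendsto (fun n : ℕ => 1 - 4 * ((n : ℝ) / L n)) atTop (𝓝 1) := by
      simpa using (tendsto_const_nhds (x := (1:ℝ))).sub (d1.const_mul 4)
    have hi : Tendsto (fun n : ℕ => 1 + 2 * ((n : ℝ) / L n)) atTop (𝓝 1) := by
      simpa using (tendsto_const_nhds (x := (1:ℝ))).add (d1.const_mul 2)
    refine tendsto_of_tendsto_of_tendsto_of_le_of_le' lo hi ?_ ?_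
    · filter_upwards [hev, hLpos] with n hn hp
      obtain ⟨h1, h2, h3, h4⟩ := main_bounds α δ hα hδ n hn.1 hn.2 (L n) κ s rfl hκ hs
      rw [le_div_iff₀ hp]
      refine le_trans (le_of_eq ?_) h3
      field_simp
    · filter_upwards [hev, hLpos] with n hn hp
      obtain ⟨h1, h2, h3, h4⟩ := main_bounds α δ hα hδ n hn.1 hn.2 (L n) κ s rfl hκ hs
      rw [div_le_iff₀ hp]
      refine h4.trans (le_of_eq ?_)
      field_simp
  have hfin := hR.div hS one_ne_zero
  rw [div_one, hκ, ← neg_div] at hfin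
  refine hfin.congr' ?_
  filter_upwards [hLpos] with n hp
  simp only [Pi.div_apply]
  rw [div_div_div_cancel_right₀ hp.ne']

end
end

section
/- Let α > 0 and δ ∈ (−1, 0) be fixed with α + δ ≤ 1/2, and set A*(δ, α; n) = min{ n^{-(1-α-δ)}, √(4(1+δ)α (log n)/n) }. Then lim_{n→∞} (log(1 − R_n(A*(δ, α; n)))) / (log n) = δ. More precisely, there exist absolute constants c, C ∈ (0, ∞) and a threshold n₀(α, δ) < ∞ such that for all n ≥ n₀(α, δ): c·n^δ ≤ 1 − R_n(A*(δ, α; n)) ≤ C·n^δ. -/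
open MeasureTheory ProbabilityTheory Real Filter Topology

noncomputable section

/-- The critical signal strength A*(δ, α; n). -/
def Astar (δ α : ℝ) (n : ℕ) : ℝ :=
  min ((n : ℝ) ^ (-(1 - α - δ))) (Real.sqrt (4 * (1 + δ) * α * Real.log n / n))


lemma pi_withDensity_aux {ι : Type*} [Fintype ι] {E : ι → Type*} {mE : ∀ i, MeasurableSpace (E i)}
    (μ : (i : ι) → Measure (E i)) [∀ i, IsProbabilityMeasure (μ i)]
    (f : (i : ι) → E i → ENNReal) (hf : ∀ i, Measurable (f i))
    [∀ i, SigmaFinite ((μ i).withDensity (f i))] :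
    (Measure.pi fun i => (μ i).withDensity (f i)) =
      (Measure.pi μ).withDensity (fun x => ∏ i, f i (x i)) := by
  refine Measure.pi_eq fun s hs => ?_
  have hS : MeasurableSet (Set.univ.pi s) := MeasurableSet.univ_pi hs
  rw [withDensity_apply _ hS, ← lintegral_indicator hS]
  have h1 : ∀ x : (i : ι) → E i, (Set.univ.pi s).indicator (fun x => ∏ i, f i (x i)) x
      = ∏ i, (s i).indicator (f i) (x i) := by
    intro x
    by_cases hx : x ∈ Set.univ.pi s
    · rw [Set.indicator_of_mem hx]
      refine Finset.prod_congr rfl fun i _ => ?_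
      rw [Set.indicator_of_mem (hx i (Set.mem_univ i))]
    · rw [Set.indicator_of_notMem hx]
      simp only [Set.mem_pi, Set.mem_univ, true_implies, not_forall] at hx
      obtain ⟨i, hi⟩ := hx
      exact (Finset.prod_eq_zero (Finset.mem_univ i) (Set.indicator_of_notMem hi _)).symm
  simp_rw [h1]
  have hm : ∀ i, Measurable ((s i).indicator (f i)) := fun i => (hf i).indicator (hs i)
  rw [lintegral_prod_eq_prod_lintegral_of_indepFun Finset.univ
    (fun i (x : (i : ι) → E i) => (s i).indicator (f i) (x i))
    (iIndepFun_pi (X := fun i => (s i).indicator (f i)) fun i => (hm i).aemeasurable)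
    (fun i => (hm i).comp (measurable_pi_apply i))]
  refine Finset.prod_congr rfl fun i _ => ?_
  rw [withDensity_apply _ (hs i), ← lintegral_indicator (hs i)]
  rw [← (measurePreserving_eval μ i).map_eq, lintegral_map (hm i) (measurable_pi_apply i)]

lemma gauss_density (t : ℝ) : gaussianReal t 1 =
    (gaussianReal 0 1).withDensity (fun x => ENNReal.ofReal (rexp (t * x - t ^ 2 / 2))) := by
  rw [gaussianReal_of_var_ne_zero _ one_ne_zero, gaussianReal_of_var_ne_zero _ one_ne_zero,
    ← withDensity_mul _ (measurable_gaussianPDF _ _) (by fun_prop)]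
  congr 1
  ext x
  simp only [Pi.mul_apply, gaussianPDF]
  rw [← ENNReal.ofReal_mul (gaussianPDFReal_nonneg _ _ _)]
  congr 1
  simp only [gaussianPDFReal, mul_assoc, ← Real.exp_add]
  congr 2
  push_cast
  ring_nf

/-- The likelihood ratio. -/
def LR (N : ℕ) (θ x : Fin N → Fin N → ℝ) : ℝ :=
  ∏ i, ∏ j, rexp (θ i j * x i j - θ i j ^ 2 / 2)

instance (N : ℕ) (θ : Fin N → Fin N → ℝ) : IsProbabilityMeasure (PTheta N θ) := by
  unfold PTheta; infer_instance

lemma PTheta_density (N : ℕ) (θ : Fin N → Fin N → ℝ) :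
    PTheta N θ = (PTheta N 0).withDensity (fun x => ENNReal.ofReal (LR N θ x)) := by
  have hin : ∀ i, (Measure.pi fun j => gaussianReal (θ i j) 1) =
      (Measure.pi fun _ : Fin N => gaussianReal 0 1).withDensity
        (fun x => ∏ j, ENNReal.ofReal (rexp (θ i j * x j - θ i j ^ 2 / 2))) := by
    intro i
    have hsf : ∀ j, SigmaFinite ((gaussianReal 0 1).withDensity
        (fun x => ENNReal.ofReal (rexp (θ i j * x - θ i j ^ 2 / 2)))) := by
      intro j; rw [← gauss_density]; infer_instance
    rw [← pi_withDensity_aux (fun _ : Fin N => gaussianReal 0 1)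
      (fun j x => ENNReal.ofReal (rexp (θ i j * x - θ i j ^ 2 / 2))) (fun j => by fun_prop)]
    congr 1
    ext1 j
    exact gauss_density _
  have hsf : ∀ i, SigmaFinite ((Measure.pi fun _ : Fin N => gaussianReal 0 1).withDensity
        (fun x => ∏ j, ENNReal.ofReal (rexp (θ i j * x j - θ i j ^ 2 / 2)))) := by
    intro i; rw [← hin]; infer_instance
  unfold PTheta
  simp_rw [hin]
  rw [pi_withDensity_aux (fun _ : Fin N => Measure.pi fun _ : Fin N => gaussianReal 0 1)
      (fun i x => ∏ j, ENNReal.ofReal (rexp (θ i j * x j - θ i j ^ 2 / 2))) (fun j => by fun_prop)]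
  simp only [Pi.zero_apply]
  congr 1
  ext x
  unfold LR
  rw [ENNReal.ofReal_prod_of_nonneg (fun i _ => by positivity)]
  refine Finset.prod_congr rfl fun i _ => ?_
  rw [ENNReal.ofReal_prod_of_nonneg (fun i _ => by positivity)]

lemma LR_nonneg (N : ℕ) (θ x : Fin N → Fin N → ℝ) : 0 ≤ LR N θ x := by
  unfold LR; positivity

lemma LR_meas (N : ℕ) (θ : Fin N → Fin N → ℝ) : Measurable (LR N θ) := by
  unfold LR; fun_prop

lemma gint (a b : ℝ) : Integrable (fun x => rexp (a * x + b)) (gaussianReal 0 1) := by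
  simp_rw [Real.exp_add]
  exact (integrable_exp_mul_gaussianReal a).mul_const _

lemma gval (a b : ℝ) : ∫ x, rexp (a * x + b) ∂(gaussianReal 0 1) = rexp (a ^ 2 / 2 + b) := by
  simp_rw [Real.exp_add]
  rw [integral_mul_const]
  have := congrFun (mgf_id_gaussianReal (μ := 0) (v := 1)) a
  simp only [mgf, id, zero_mul, zero_add, NNReal.coe_one, one_mul] at this
  rw [this]

lemma LR_mul (N : ℕ) (θ θ' x : Fin N → Fin N → ℝ) : LR N θ x * LR N θ' x =
    ∏ i, ∏ j, rexp ((θ i j + θ' i j) * x i j + (- θ i j ^ 2 / 2 - θ' i j ^ 2 / 2)) := by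
  unfold LR
  simp_rw [← Finset.prod_mul_distrib, ← Real.exp_add]
  refine Finset.prod_congr rfl fun i _ => Finset.prod_congr rfl fun j _ => ?_
  congr 1; ring

lemma LR_mul_int (N : ℕ) (θ θ' : Fin N → Fin N → ℝ) :
    Integrable (fun x => LR N θ x * LR N θ' x) (PTheta N 0) := by
  simp_rw [LR_mul]
  unfold PTheta
  exact Integrable.fintype_prod (fun i => Integrable.fintype_prod
    (f := fun j y => rexp ((θ i j + θ' i j) * y + (- θ i j ^ 2 / 2 - θ' i j ^ 2 / 2)))
    (fun j => gint _ _))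

lemma LR_mul_val (N : ℕ) (θ θ' : Fin N → Fin N → ℝ) :
    ∫ x, LR N θ x * LR N θ' x ∂(PTheta N 0) = rexp (∑ i, ∑ j, θ i j * θ' i j) := by
  simp_rw [LR_mul]
  unfold PTheta
  rw [integral_fintype_prod_eq_prod (fun i (y : Fin N → ℝ) => ∏ j, 
    rexp ((θ i j + θ' i j) * y j + (- θ i j ^ 2 / 2 - θ' i j ^ 2 / 2)))]
  rw [Real.exp_sum]
  refine Finset.prod_congr rfl fun i _ => ?_
  rw [integral_fintype_prod_eq_prod (fun j (y : ℝ) => 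
    rexp ((θ i j + θ' i j) * y + (- θ i j ^ 2 / 2 - θ' i j ^ 2 / 2)))]
  rw [Real.exp_sum]
  refine Finset.prod_congr rfl fun j _ => ?_
  simp only [Pi.zero_apply]
  rw [gval]; congr 1; ring

lemma LR_zero (N : ℕ) (x : Fin N → Fin N → ℝ) : LR N 0 x = 1 := by
  simp [LR]

lemma LR_int (N : ℕ) (θ : Fin N → Fin N → ℝ) : Integrable (LR N θ) (PTheta N 0) := by
  simpa [LR_zero] using LR_mul_int N θ 0

lemma LR_val (N : ℕ) (θ : Fin N → Fin N → ℝ) : ∫ x, LR N θ x ∂(PTheta N 0) = 1 := by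
  simpa [LR_zero] using LR_mul_val N θ 0

lemma PTheta_apply (N : ℕ) (θ : Fin N → Fin N → ℝ) {T : Set (Fin N → Fin N → ℝ)}
    (hT : MeasurableSet T) : (PTheta N θ T).toReal = ∫ x in T, LR N θ x ∂(PTheta N 0) := by
  rw [PTheta_density, withDensity_apply _ hT, integral_eq_lintegral_of_nonneg_ae
    (ae_of_all _ fun x => LR_nonneg N θ x) (LR_meas N θ).aestronglyMeasurable]

lemma bayes_bound (n N : ℕ) (A : ℝ) {Ω : Type*} [Fintype Ω] [Nonempty Ω]
    (θ : Ω → Fin N → Fin N → ℝ) (hθ : ∀ w, θ w ∈ ThetaSet A n N) {ε : ℝ} (hε : 0 < ε)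
    {T : Set (Fin N → Fin N → ℝ)} (hT : MeasurableSet T) {B : ℝ}
    (hB : (∑ w, ∑ w', rexp (∑ i, ∑ j, θ w i j * θ w' i j)) ≤ (Fintype.card Ω : ℝ) ^ 2 * B) :
    1 - testRisk n N A T ≤ ε / 2 + (B - 1) / (2 * ε) := by
  set M : ℝ := ((Fintype.card Ω : ℕ) : ℝ) with hM
  have hMpos : 0 < M := by rw [hM]; exact_mod_cast Fintype.card_pos
  set S := ⨆ θ : ThetaSet A n N, (PTheta N θ.1 Tᶜ).toReal with hS
  have hle : ∀ w, (PTheta N (θ w) Tᶜ).toReal ≤ S := by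
    intro w
    refine le_ciSup (f := fun θ : ThetaSet A n N => (PTheta N θ.1 Tᶜ).toReal) ?_ ⟨θ w, hθ w⟩
    refine ⟨1, ?_⟩
    rintro _ ⟨t, rfl⟩
    exact measureReal_le_one
  have hc : ∀ w, (PTheta N (θ w) Tᶜ).toReal = 1 - ∫ x in T, LR N (θ w) x ∂(PTheta N 0) := by
    intro w
    rw [← PTheta_apply _ _ hT]
    exact probReal_compl_eq_one_sub hT
  let L : (Fin N → Fin N → ℝ) → ℝ := fun x => M⁻¹ * ∑ w, LR N (θ w) x
  have hLint : Integrable L (PTheta N 0) :=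
    (integrable_finsetSum _ fun w _ => LR_int N (θ w)).const_mul _
  have hL1 : ∫ x, L x ∂(PTheta N 0) = 1 := by
    simp only [L]
    rw [integral_const_mul, integral_finsetSum _ fun w _ => LR_int N (θ w)]
    simp_rw [LR_val]
    simp [← hM, hMpos.ne']
  have hsq : ∀ x, L x ^ 2 = M⁻¹ ^ 2 * ∑ w, ∑ w', LR N (θ w) x * LR N (θ w') x := by
    intro x
    simp only [L]
    rw [mul_pow, pow_two (∑ w, _), Finset.sum_mul_sum]
  have hL2int : Integrable (fun x => L x ^ 2) (PTheta N 0) := by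
    simp_rw [hsq]
    exact (integrable_finsetSum _ fun w _ => integrable_finsetSum _ fun w' _ =>
      LR_mul_int N (θ w) (θ w')).const_mul _
  have hL2 : ∫ x, L x ^ 2 ∂(PTheta N 0) ≤ B := by
    simp_rw [hsq]
    rw [integral_const_mul, integral_finsetSum _ fun w _ => integrable_finsetSum _ fun w' _ =>
      LR_mul_int N (θ w) (θ w')]
    simp_rw [integral_finsetSum _ fun w' _ => LR_mul_int N (θ _) (θ w'), LR_mul_val]
    calc _ ≤ M⁻¹ ^ 2 * (M ^ 2 * B) := by gcongr
      _ = B := by field_simp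
  have hTL : ∫ x in T, L x ∂(PTheta N 0) = M⁻¹ * ∑ w, ∫ x in T, LR N (θ w) x ∂(PTheta N 0) := by
    simp only [L]
    rw [integral_const_mul, integral_finsetSum _ fun w _ => (LR_int N (θ w)).integrableOn]
  have hSge : 1 - ∫ x in T, L x ∂(PTheta N 0) ≤ S := by
    have h1 : ∑ w, (1 - ∫ x in T, LR N (θ w) x ∂(PTheta N 0)) ≤ ∑ _w : Ω, S :=
      Finset.sum_le_sum fun w _ => by rw [← hc]; exact hle w
    rw [Finset.sum_sub_distrib] at h1
    simp only [Finset.sum_const, Finset.card_univ, nsmul_eq_mul, ← hM, mul_one] at h1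
    rw [hTL]
    have : M⁻¹ * (M - ∑ w, ∫ x in T, LR N (θ w) x ∂(PTheta N 0)) ≤ M⁻¹ * (M * S) := by gcongr
    rw [mul_sub, inv_mul_cancel₀ hMpos.ne', inv_mul_cancel_left₀ hMpos.ne'] at this
    exact this
  have hP0 : (PTheta N 0 T).toReal = ∫ x in T, (1:ℝ) ∂(PTheta N 0) := by
    simp [Measure.real]
  have hIntg : Integrable (fun x => ε / 2 + (L x ^ 2 - 2 * L x + 1) / (2 * ε)) (PTheta N 0) := by
    fun_prop
  have key : ∫ x in T, (L x - 1) ∂(PTheta N 0) ≤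
      ∫ x, (ε / 2 + (L x ^ 2 - 2 * L x + 1) / (2 * ε)) ∂(PTheta N 0) := by
    have hnn : ∀ x, 0 ≤ ε / 2 + (L x ^ 2 - 2 * L x + 1) / (2 * ε) := fun x => by
      have : L x ^ 2 - 2 * L x + 1 = (L x - 1) ^ 2 := by ring
      rw [this]; positivity
    refine le_trans (integral_mono (hLint.sub (integrable_const _)).integrableOn
      hIntg.integrableOn fun x => ?_) (setIntegral_le_integral hIntg (ae_of_all _ hnn))
    have : ε / 2 + (L x ^ 2 - 2 * L x + 1) / (2 * ε) - (L x - 1) = (L x - 1 - ε) ^ 2 / (2 * ε) := by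
      field_simp; ring
    have h2 : 0 ≤ (L x - 1 - ε) ^ 2 / (2 * ε) := by positivity
    show L x - 1 ≤ _
    linarith
  have hval : ∫ x, (ε / 2 + (L x ^ 2 - 2 * L x + 1) / (2 * ε)) ∂(PTheta N 0) 
      = ε / 2 + (∫ x, L x ^ 2 ∂(PTheta N 0) - 1) / (2 * ε) := by
    rw [integral_add (by fun_prop) (by fun_prop),
      integral_div (2 * ε) (fun x => L x ^ 2 - 2 * L x + 1),
      integral_add (by fun_prop) (by fun_prop), integral_sub (by fun_prop) (by fun_prop),
      integral_const_mul, hL1]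
    simp
    ring
  rw [hval] at key
  rw [integral_sub hLint.integrableOn (integrable_const _).integrableOn] at key
  have h3 : (∫ x, L x ^ 2 ∂(PTheta N 0) - 1) / (2 * ε) ≤ (B - 1) / (2 * ε) := by gcongr
  unfold testRisk
  rw [← hS, hP0]
  linarith


/-- number of agreements -/
def agree {n m : ℕ} (f g : Fin n → Fin m) : ℝ := ∑ k, if f k = g k then (1:ℝ) else 0

lemma agree_nonneg {n m : ℕ} (f g : Fin n → Fin m) : 0 ≤ agree f g :=
  Finset.sum_nonneg fun k _ => by split_ifs <;> norm_num

lemma agree_le {n m : ℕ} (f g : Fin n → Fin m) : agree f g ≤ n := by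
  calc agree f g ≤ ∑ _k : Fin n, (1:ℝ) :=
        Finset.sum_le_sum fun k _ => by split_ifs <;> norm_num
    _ = n := by simp

lemma agree_mgf {n m : ℕ} (hm : 0 < m) (f : Fin n → Fin m) (s : ℝ) :
    ∑ g : Fin n → Fin m, rexp (s * agree f g) ≤
      (m : ℝ) ^ n * rexp ((n : ℝ) / m * (rexp s - 1)) := by
  have hm' : (0:ℝ) < m := by exact_mod_cast hm
  have h1 : ∀ g : Fin n → Fin m, rexp (s * agree f g) =
      ∏ k, (fun (k : Fin n) (y : Fin m) => if f k = y then rexp s else 1) k (g k) := by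
    intro g
    unfold agree
    rw [Finset.mul_sum, Real.exp_sum]
    refine Finset.prod_congr rfl fun k _ => ?_
    simp only
    split_ifs <;> simp
  simp_rw [h1]
  rw [← Fintype.prod_sum (fun (k : Fin n) (y : Fin m) => if f k = y then rexp s else 1)]
  have h2 : ∀ k : Fin n, (∑ y : Fin m, if f k = y then rexp s else 1) = m + (rexp s - 1) := by
    intro k
    have : ∀ y : Fin m, (if f k = y then rexp s else 1) = 1 + if f k = y then rexp s - 1 else 0 := by
      intro y; split_ifs <;> ring
    simp_rw [this, Finset.sum_add_distrib]
    simp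
  simp_rw [h2]
  simp only [Finset.prod_const, Finset.card_univ, Fintype.card_fin]
  have h3 : (m : ℝ) + (rexp s - 1) = m * (1 + (rexp s - 1) / m) := by field_simp
  have h4 : 0 ≤ 1 + (rexp s - 1) / m := by
    have : (1:ℝ) ≤ m := by exact_mod_cast hm
    have h5 := Real.exp_pos s
    have : 1 + (rexp s - 1) / m = (m - 1 + rexp s) / m := by field_simp; ring
    rw [this]; exact div_nonneg (by linarith) hm'.le
  rw [h3, mul_pow]
  gcongr
  calc (1 + (rexp s - 1) / m) ^ n ≤ (rexp ((rexp s - 1) / m)) ^ n := by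
        gcongr
        rw [add_comm]; exact Real.add_one_le_exp _
    _ = _ := by rw [← Real.exp_nat_mul]; congr 1; ring

lemma exp_sub_one_le_two {s : ℝ} (h0 : 0 ≤ s) (h1 : s ≤ 1) : rexp s - 1 ≤ 2 * s := by
  have := Real.abs_exp_sub_one_le (x := s) (by rwa [abs_of_nonneg h0])
  rw [abs_of_nonneg h0] at this
  exact (le_abs_self _).trans this

lemma second_moment_s3 {n m : ℕ} (hm : 0 < m) {A : ℝ} (h1 : A ^ 2 * n ≤ 1)
    (h2 : 2 * ((n : ℝ) / m) * A ^ 2 ≤ 1) (h3 : 4 * ((n : ℝ) / m) ^ 2 * A ^ 2 ≤ 1) :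
    ∑ w : (Fin n → Fin m) × (Fin n → Fin m), ∑ w' : (Fin n → Fin m) × (Fin n → Fin m),
      rexp (A ^ 2 * agree w.1 w'.1 * agree w.2 w'.2) ≤
    (Fintype.card ((Fin n → Fin m) × (Fin n → Fin m)) : ℝ) ^ 2 *
      (1 + 8 * ((n : ℝ) / m) ^ 2 * A ^ 2) := by
  set q : ℝ := (n : ℝ) / m with hq
  have hq0 : 0 ≤ q := by positivity
  have hcard : (Fintype.card ((Fin n → Fin m) × (Fin n → Fin m)) : ℝ) = (m : ℝ) ^ n * (m : ℝ) ^ n := by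
    simp
  have key : ∀ w : (Fin n → Fin m) × (Fin n → Fin m),
      ∑ w' : (Fin n → Fin m) × (Fin n → Fin m),
        rexp (A ^ 2 * agree w.1 w'.1 * agree w.2 w'.2) ≤
      (m : ℝ) ^ n * ((m : ℝ) ^ n * (1 + 8 * q ^ 2 * A ^ 2)) := by
    rintro ⟨f, g⟩
    rw [Fintype.sum_prod_type]
    simp only
    have hs : ∀ f' : Fin n → Fin m, ∑ g' : Fin n → Fin m, rexp (A ^ 2 * agree f f' * agree g g') ≤
        (m : ℝ) ^ n * rexp (2 * q * A ^ 2 * agree f f') := by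
      intro f'
      refine (agree_mgf hm g _).trans ?_
      have ha0 := agree_nonneg f f'
      have ha1 := agree_le f f'
      have := exp_sub_one_le_two (s := A ^ 2 * agree f f') (by positivity)
        (le_trans (by gcongr) h1)
      refine mul_le_mul_of_nonneg_left (Real.exp_le_exp.2 ?_) (by positivity)
      calc (n : ℝ) / m * (rexp (A ^ 2 * agree f f') - 1) ≤ q * (2 * (A ^ 2 * agree f f')) :=
            mul_le_mul_of_nonneg_left this hq0
        _ = _ := by ring
    refine (Finset.sum_le_sum fun f' _ => hs f').trans ?_
    rw [← Finset.mul_sum]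
    gcongr
    refine (agree_mgf hm f _).trans ?_
    gcongr
    have h4 := exp_sub_one_le_two (s := 2 * q * A ^ 2) (by positivity) h2
    have h5 : q * (rexp (2 * q * A ^ 2) - 1) ≤ 4 * q ^ 2 * A ^ 2 := by
      calc _ ≤ q * (2 * (2 * q * A ^ 2)) := by gcongr
        _ = _ := by ring
    have h6 := exp_sub_one_le_two (s := 4 * q ^ 2 * A ^ 2) (by positivity) h3
    calc _ ≤ rexp (4 * q ^ 2 * A ^ 2) := by gcongr
      _ ≤ _ := by linarith
  refine (Finset.sum_le_sum fun w _ => key w).trans ?_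
  simp only [Finset.sum_const, Finset.card_univ, nsmul_eq_mul]
  rw [hcard]
  apply le_of_eq; ring

/-- transversal row set -/
def tset {n m N : ℕ} (e : Fin n × Fin m ↪ Fin N) (f : Fin n → Fin m) : Finset (Fin N) :=
  Finset.univ.image fun k => e (k, f k)

lemma tset_inj {n m N : ℕ} (e : Fin n × Fin m ↪ Fin N) (f : Fin n → Fin m) :
    Function.Injective fun k => e (k, f k) := fun a b h => by
  have := e.injective h
  simpa using (Prod.ext_iff.1 this).1

lemma tset_card {n m N : ℕ} (e : Fin n × Fin m ↪ Fin N) (f : Fin n → Fin m) :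
    (tset e f).card = n := by
  rw [tset, Finset.card_image_of_injective _ (tset_inj e f)]; simp

lemma tset_overlap {n m N : ℕ} (e : Fin n × Fin m ↪ Fin N) (f g : Fin n → Fin m) :
    ∑ i, (if i ∈ tset e f then (1:ℝ) else 0) * (if i ∈ tset e g then (1:ℝ) else 0) = agree f g := by
  simp_rw [ite_mul, one_mul, zero_mul]
  rw [Finset.sum_ite_mem, Finset.univ_inter]
  nth_rewrite 1 [tset]
  rw [Finset.sum_image (fun a _ b _ h => tset_inj e f h)]
  unfold agree
  refine Finset.sum_congr rfl fun k _ => ?_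
  congr 1
  simp only [tset, Finset.mem_image, Finset.mem_univ, true_and, EmbeddingLike.apply_eq_iff_eq,
    Prod.mk.injEq, exists_eq_left, eq_iff_iff]
  exact eq_comm

lemma upper_bound {n m N : ℕ} (hm : 0 < m) (hN : n * m ≤ N) {A ε : ℝ} (hε : 0 < ε)
    (h1 : A ^ 2 * n ≤ 1)
    (h2 : 2 * ((n : ℝ) / m) * A ^ 2 ≤ 1) (h3 : 4 * ((n : ℝ) / m) ^ 2 * A ^ 2 ≤ 1) :
    1 - minimaxRisk n N A ≤ ε / 2 + (8 * ((n : ℝ) / m) ^ 2 * A ^ 2) / (2 * ε) := by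
  have : Nonempty (Fin n × Fin m ↪ Fin N) := by
    apply Function.Embedding.nonempty_of_card_le; simpa using hN
  obtain ⟨e⟩ := this
  have : Nonempty (Fin n → Fin m) := ⟨fun _ => ⟨0, hm⟩⟩
  let θ : ((Fin n → Fin m) × (Fin n → Fin m)) → Fin N → Fin N → ℝ := fun w i j =>
    A * (if i ∈ tset e w.1 then (1:ℝ) else 0) * (if j ∈ tset e w.2 then (1:ℝ) else 0)
  have hθ : ∀ w, θ w ∈ ThetaSet A n N := by
    intro w
    refine ⟨tset e w.1, tset e w.2, tset_card _ _, tset_card _ _, ?_, ?_⟩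
    · intro i j hi hj; simp [θ, hi, hj]
    · intro i j h
      simp only [θ]
      by_cases hi : i ∈ tset e w.1
      · have : j ∉ tset e w.2 := fun hj => h ⟨hi, hj⟩
        simp [this]
      · simp [hi]
  have hinner : ∀ w w', ∑ i, ∑ j, θ w i j * θ w' i j = A ^ 2 * agree w.1 w'.1 * agree w.2 w'.2 := by
    intro w w'
    rw [← tset_overlap e w.1, ← tset_overlap e w.2, mul_assoc, Finset.sum_mul_sum, Finset.mul_sum]
    refine Finset.sum_congr rfl fun i _ => ?_
    rw [Finset.mul_sum]
    refine Finset.sum_congr rfl fun j _ => ?_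
    simp only [θ]; ring
  have hB := second_moment_s3 hm h1 h2 h3
  simp_rw [← hinner] at hB
  have hne : Nonempty {T : Set (Fin N → Fin N → ℝ) // MeasurableSet T} := ⟨⟨∅, MeasurableSet.empty⟩⟩
  have : 1 - (ε / 2 + (8 * ((n : ℝ) / m) ^ 2 * A ^ 2) / (2 * ε)) ≤ minimaxRisk n N A := by
    refine le_ciInf fun T => ?_
    have := bayes_bound n N A θ hθ hε T.2 hB
    rw [add_sub_cancel_left] at this
    linarith
  linarith

lemma gauss_sum {ι : Type*} [Fintype ι] (m : ι → ℝ) (v : NNReal) :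
    (Measure.pi fun i => gaussianReal (m i) v).map (fun x => ∑ i, x i) =
      gaussianReal (∑ i, m i) (Fintype.card ι * v) := by
  have : IsProbabilityMeasure ((Measure.pi fun i => gaussianReal (m i) v).map
    (fun x => ∑ i, x i)) := Measure.isProbabilityMeasure_map (by fun_prop)
  apply Measure.ext_of_charFun
  rw [charFun_map_sum_pi_eq_prod]
  ext t
  simp only [Finset.prod_apply, charFun_gaussianReal]
  rw [← Complex.exp_sum]
  congr 1
  push_cast
  rw [Finset.sum_sub_distrib]
  simp [Finset.mul_sum, Finset.sum_mul]
  ring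

lemma PTheta_sum (N : ℕ) (θ : Fin N → Fin N → ℝ) :
    (PTheta N θ).map (fun x => ∑ i, ∑ j, x i j) =
      gaussianReal (∑ i, ∑ j, θ i j) ((N : NNReal) ^ 2) := by
  have h : (fun x : Fin N → Fin N → ℝ => ∑ i, ∑ j, x i j) =
      (fun y : Fin N → ℝ => ∑ i, y i) ∘ (fun x i => ∑ j, x i j) := rfl
  rw [h, ← Measure.map_map (by fun_prop) (by fun_prop)]
  unfold PTheta
  have : ∀ i, IsProbabilityMeasure (Measure.map (fun y : Fin N → ℝ => ∑ j, y j)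
    (Measure.pi fun j => gaussianReal (θ i j) 1)) :=
    fun i => Measure.isProbabilityMeasure_map (by fun_prop)
  rw [Measure.pi_map_pi (f := fun i (y : Fin N → ℝ) => ∑ j, y j) (fun i => by fun_prop)]
  simp_rw [gauss_sum]
  simp [pow_two]

lemma lower_bound {n N : ℕ} (hN : 0 < N) {A : ℝ} (hA : 0 ≤ A) :
    ((n : ℝ) ^ 2 * A / N) * ((√(2 * π))⁻¹ * rexp (-((n : ℝ) ^ 2 * A / N) ^ 2 / 2)) ≤
      1 - minimaxRisk n N A := by
  set t : ℝ := (n : ℝ) ^ 2 * A with ht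
  have ht0 : 0 ≤ t := by positivity
  have hN' : (0:ℝ) < N := by exact_mod_cast hN
  set v : NNReal := (N : NNReal) ^ 2 with hv
  have hv0 : v ≠ 0 := by rw [hv]; positivity
  set S : (Fin N → Fin N → ℝ) → ℝ := fun x => ∑ i, ∑ j, x i j with hS
  have hSm : Measurable S := by rw [hS]; fun_prop
  let T : Set (Fin N → Fin N → ℝ) := S ⁻¹' (Set.Ioi t)
  have hT : MeasurableSet T := hSm measurableSet_Ioi
  have hTc : Tᶜ = S ⁻¹' (Set.Iic t) := by simp [T, ← Set.preimage_compl]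
  have hlaw : ∀ θ : Fin N → Fin N → ℝ, ∀ s, MeasurableSet s → (PTheta N θ (S ⁻¹' s)).toReal =
      (gaussianReal (∑ i, ∑ j, θ i j) v).real s := by
    intro θ s hs
    rw [← PTheta_sum, Measure.real, Measure.map_apply hSm hs]
  have hsup : ⨆ θ : ThetaSet A n N, (PTheta N θ.1 Tᶜ).toReal ≤ (gaussianReal 0 v).real (Set.Iic 0) := by
    refine Real.iSup_le ?_ measureReal_nonneg
    rintro ⟨θ, R, C, hR, hC, h1, h2⟩
    rw [hTc, hlaw _ _ measurableSet_Iic]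
    set M := ∑ i, ∑ j, θ i j with hMdef
    have hM : t ≤ M := by
      have hle : ∀ i j, A * (if i ∈ R then (1:ℝ) else 0) * (if j ∈ C then (1:ℝ) else 0) ≤ θ i j := by
        intro i j
        by_cases hi : i ∈ R
        · by_cases hj : j ∈ C
          · simpa [hi, hj] using h1 i j hi hj
          · simp [hj, h2 i j (by tauto)]
        · simp [hi, h2 i j (by tauto)]
      have : t = ∑ i, ∑ j, A * (if i ∈ R then (1:ℝ) else 0) * (if j ∈ C then (1:ℝ) else 0) := by
        simp_rw [← Finset.mul_sum, ← Finset.sum_mul, ← Finset.mul_sum]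
        simp [hR, hC, ht]; ring
      rw [this]
      exact Finset.sum_le_sum fun i _ => Finset.sum_le_sum fun j _ => hle i j
    have hshift : gaussianReal M v = (gaussianReal 0 v).map (fun x => x + M) := by
      rw [gaussianReal_map_add_const]; simp
    rw [hshift, map_measureReal_apply (by fun_prop) measurableSet_Iic]
    refine measureReal_mono ?_
    intro x hx
    simp only [Set.mem_preimage, Set.mem_Iic] at hx ⊢
    linarith
  have h0 : (PTheta N 0 T).toReal = 1 - (gaussianReal 0 v).real (Set.Iic t) := by
    rw [hlaw _ _ measurableSet_Ioi, ← probReal_compl_eq_one_sub measurableSet_Iic]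
    simp
  have hmm : minimaxRisk n N A ≤ testRisk n N A T := by
    refine ciInf_le (f := fun T : {T : Set (Fin N → Fin N → ℝ) // MeasurableSet T} =>
      testRisk n N A T.1) ⟨0, ?_⟩ ⟨T, hT⟩
    rintro _ ⟨T', rfl⟩
    exact add_nonneg ENNReal.toReal_nonneg (Real.iSup_nonneg fun _ => ENNReal.toReal_nonneg)
  have hdiff : (gaussianReal 0 v).real (Set.Iic t) =
      (gaussianReal 0 v).real (Set.Iic 0) + (gaussianReal 0 v).real (Set.Ioc 0 t) := by
    rw [← measureReal_union (by
      rw [Set.disjoint_left]; intro x hx hx'; exact absurd hx'.1 (not_lt.2 hx)) measurableSet_Ioc,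
      Set.Iic_union_Ioc_eq_Iic ht0]
  have hI : (t / N) * ((√(2 * π))⁻¹ * rexp (-(t / N) ^ 2 / 2)) ≤
      (gaussianReal 0 v).real (Set.Ioc 0 t) := by
    rw [Measure.real, gaussianReal_apply_eq_integral _ hv0, ENNReal.toReal_ofReal
      (setIntegral_nonneg measurableSet_Ioc fun x _ => gaussianPDFReal_nonneg _ _ _)]
    have hpt : ∀ x ∈ Set.Ioc 0 t, (N : ℝ)⁻¹ * ((√(2 * π))⁻¹ * rexp (-(t / N) ^ 2 / 2)) ≤
        gaussianPDFReal 0 v x := by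
      intro x hx
      have hsq : √(2 * π * (v : ℝ)) = √(2 * π) * N := by
        rw [hv]; push_cast
        rw [Real.sqrt_mul (by positivity), Real.sqrt_sq hN'.le]
      rw [gaussianPDFReal, hsq, mul_inv, ← mul_assoc, mul_comm (N : ℝ)⁻¹]
      refine mul_le_mul_of_nonneg_left (Real.exp_le_exp.2 ?_) (by positivity)
      rw [sub_zero, hv]
      push_cast
      rw [neg_div, neg_div, div_pow, div_div, mul_comm (2:ℝ)]
      gcongr
      · exact hx.1.le
      · exact hx.2
    have hconst : (t / N) * ((√(2 * π))⁻¹ * rexp (-(t / N) ^ 2 / 2)) =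
        ∫ x in Set.Ioc 0 t, (N : ℝ)⁻¹ * ((√(2 * π))⁻¹ * rexp (-(t / N) ^ 2 / 2)) := by
      rw [setIntegral_const]
      simp [ht0]
      ring
    rw [hconst]
    refine setIntegral_mono_on ?_ (integrable_gaussianPDFReal _ _).integrableOn
      measurableSet_Ioc hpt
    exact integrableOn_const (by simp)
  unfold testRisk at hmm
  linarith


lemma main_bounds_s3 (α δ : ℝ) (hα : 0 < α) (hδ1 : -1 < δ) (hδ0 : δ < 0) (hαδ : α + δ ≤ 1 / 2) :
    ∃ n₀ : ℕ, ∀ n : ℕ, n₀ ≤ n →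
      ((√(2 * π))⁻¹ * rexp (-2)) * (n : ℝ) ^ δ ≤
        1 - minimaxRisk n ⌊(n : ℝ) ^ (1 + α)⌋₊ (Astar δ α n) ∧
      1 - minimaxRisk n ⌊(n : ℝ) ^ (1 + α)⌋₊ (Astar δ α n) ≤ 17 * (n : ℝ) ^ δ := by
  rw [← eventually_atTop]
  have e2 : ∀ᶠ n : ℕ in atTop, (2:ℝ) ≤ (n : ℝ) ^ α :=
    ((tendsto_rpow_atTop hα).comp tendsto_natCast_atTop_atTop).eventually_ge_atTop 2
  have e3 : ∀ᶠ n : ℕ in atTop, (n : ℝ) ^ δ < 1 / 16 := by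
    have h := ((tendsto_rpow_neg_atTop (y := -δ) (by linarith)).comp
      (tendsto_natCast_atTop_atTop (R := ℝ))).eventually_lt_const
        (show (0:ℝ) < 1 / 16 by norm_num)
    simpa using h
  have e4 : ∀ᶠ n : ℕ in atTop, 1 / (4 * (1 + δ) * α) ≤ Real.log n :=
    (Real.tendsto_log_atTop.comp tendsto_natCast_atTop_atTop).eventually_ge_atTop _
  filter_upwards [e2, e3, e4, eventually_ge_atTop 1] with n h2 h3 h4 h1
  have hn1 : (1:ℝ) ≤ n := by exact_mod_cast h1
  have hn : (0:ℝ) < n := by linarith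
  have hkk : 0 < 4 * (1 + δ) * α := by
    have : 0 < 1 + δ := by linarith
    positivity
  have h4' : 1 ≤ 4 * (1 + δ) * α * Real.log n := by
    rw [div_le_iff₀ hkk] at h4; linarith
  set a : ℝ := (n : ℝ) ^ (-(1 - α - δ)) with ha
  have ha0 : 0 < a := Real.rpow_pos_of_pos hn _
  have hA : Astar δ α n = a := by
    unfold Astar
    rw [min_eq_left]
    apply Real.le_sqrt_of_sq_le
    rw [← Real.rpow_natCast, ← Real.rpow_mul hn.le, le_div_iff₀ hn]
    nth_rewrite 2 [← Real.rpow_one (n : ℝ)]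
    rw [← Real.rpow_add hn]
    refine le_trans ?_ h4'
    exact Real.rpow_le_one_of_one_le_of_nonpos hn1 (by push_cast; linarith)
  rw [hA]
  set r : ℝ := (n : ℝ) ^ δ with hr
  have hr0 : 0 < r := Real.rpow_pos_of_pos hn _
  have hra : a * n = r * (n : ℝ) ^ α := by
    nth_rewrite 1 [← Real.rpow_one (n : ℝ)]
    rw [ha, hr, ← Real.rpow_add hn, ← Real.rpow_add hn]; congr 1; ring
  set y : ℝ := (n : ℝ) ^ α with hy
  have hN1 : (n : ℝ) ^ (1 + α) = n * y := by rw [Real.rpow_add hn, Real.rpow_one]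
  rw [hN1]
  constructor
  · set N : ℕ := ⌊(n : ℝ) * y⌋₊ with hN
    have hny : 2 ≤ (n : ℝ) * y := by nlinarith
    have hNle : (N : ℝ) ≤ n * y := Nat.floor_le (by linarith)
    have hNge : (n : ℝ) * y / 2 ≤ N := by
      have := Nat.lt_floor_add_one ((n : ℝ) * y)
      rw [← hN] at this
      linarith
    have hNpos : (0:ℝ) < N := by linarith
    have hlb := lower_bound (n := n) (N := N) (by exact_mod_cast hNpos) ha0.le
    refine le_trans ?_ hlb
    have hq1 : r ≤ (n : ℝ) ^ 2 * a / N := by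
      rw [le_div_iff₀ hNpos]
      have : (n : ℝ) ^ 2 * a = r * (n * y) := by
        calc (n : ℝ) ^ 2 * a = n * (a * n) := by ring
          _ = _ := by rw [hra]; ring
      rw [this]
      exact mul_le_mul_of_nonneg_left hNle hr0.le
    have hq2 : (n : ℝ) ^ 2 * a / N ≤ 2 := by
      rw [div_le_iff₀ hNpos]
      have : (n : ℝ) ^ 2 * a = r * (n * y) := by
        calc (n : ℝ) ^ 2 * a = n * (a * n) := by ring
          _ = _ := by rw [hra]; ring
      rw [this]
      nlinarith
    set Q := (n : ℝ) ^ 2 * a / N with hQ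
    have hQ0 : 0 ≤ Q := hr0.le.trans hq1
    have hexp : rexp (-2) ≤ rexp (-Q ^ 2 / 2) := by
      apply Real.exp_le_exp.2; nlinarith
    rw [mul_comm]
    gcongr
  · set m : ℕ := ⌊y⌋₊ with hm
    have hmge : y / 2 ≤ m := by
      have := Nat.lt_floor_add_one y
      rw [← hm] at this
      linarith
    have hmle : (m : ℝ) ≤ y := Nat.floor_le (by linarith)
    have hmpos : (0:ℝ) < m := by linarith
    have hnm : n * m ≤ ⌊(n : ℝ) * y⌋₊ := by
      apply Nat.le_floor; push_cast; gcongr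
    have hq : (n : ℝ) / m * a ≤ 2 * r := by
      rw [div_mul_eq_mul_div, mul_comm, hra, div_le_iff₀ hmpos]
      nlinarith
    have hq0 : 0 ≤ (n : ℝ) / m * a := by positivity
    have hsq : ((n : ℝ) / m) ^ 2 * a ^ 2 ≤ 4 * r ^ 2 := by
      rw [← mul_pow]; nlinarith
    have hale : a ≤ 1 := Real.rpow_le_one_of_one_le_of_nonpos hn1 (by linarith)
    have hub := upper_bound (n := n) (m := m) (A := a) (ε := r) (by exact_mod_cast hmpos) hnm hr0
      (by
        rw [ha, ← Real.rpow_natCast, ← Real.rpow_mul hn.le]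
        nth_rewrite 2 [← Real.rpow_one (n : ℝ)]
        rw [← Real.rpow_add hn]
        exact Real.rpow_le_one_of_one_le_of_nonpos hn1 (by push_cast; linarith))
      (by
        have : 2 * ((n : ℝ) / m) * a ^ 2 = 2 * ((n : ℝ) / m * a) * a := by ring
        rw [this]
        nlinarith)
      (by nlinarith)
    refine hub.trans ?_
    have : 8 * ((n : ℝ) / m) ^ 2 * a ^ 2 / (2 * r) ≤ 16 * r := by
      rw [div_le_iff₀ (by positivity)]
      nlinarith
    linarith

/-- **Dense below-boundary regime.**  For fixed α > 0 and δ ∈ (−1, 0) with α + δ ≤ 1/2,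
with `N = ⌊n^{1+α}⌋`: the quantity 1 − R_n(A*(δ,α;n)) satisfies
`log(1 − R_n(A*)) / log n → δ`; more precisely, there are absolute constants c, C > 0
and a threshold n₀(α, δ) such that `c n^δ ≤ 1 − R_n(A*) ≤ C n^δ` for all n ≥ n₀. -/
theorem dense_below_boundary :
    (∀ α δ : ℝ, 0 < α → -1 < δ → δ < 0 → α + δ ≤ 1 / 2 →
      Tendsto (fun n : ℕ =>
          Real.log (1 - minimaxRisk n ⌊(n : ℝ) ^ (1 + α)⌋₊ (Astar δ α n)) / Real.log n)
        atTop (𝓝 δ)) ∧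
    ∃ c C : ℝ, 0 < c ∧ 0 < C ∧
      ∀ α δ : ℝ, 0 < α → -1 < δ → δ < 0 → α + δ ≤ 1 / 2 →
        ∃ n₀ : ℕ, ∀ n : ℕ, n₀ ≤ n →
          c * (n : ℝ) ^ δ ≤ 1 - minimaxRisk n ⌊(n : ℝ) ^ (1 + α)⌋₊ (Astar δ α n) ∧
          1 - minimaxRisk n ⌊(n : ℝ) ^ (1 + α)⌋₊ (Astar δ α n) ≤ C * (n : ℝ) ^ δ := by
  have hc : 0 < (√(2 * π))⁻¹ * rexp (-2) := by positivity
  refine ⟨?_, (√(2 * π))⁻¹ * rexp (-2), 17, hc, by norm_num, main_bounds_s3⟩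
  intro α δ hα hδ1 hδ0 hαδ
  obtain ⟨n₀, h⟩ := main_bounds_s3 α δ hα hδ1 hδ0 hαδ
  have hlog : Tendsto (fun n : ℕ => Real.log n) atTop atTop :=
    Real.tendsto_log_atTop.comp tendsto_natCast_atTop_atTop
  have hlim : ∀ K : ℝ, Tendsto (fun n : ℕ => K / Real.log n + δ) atTop (𝓝 δ) := by
    intro K
    simpa using (hlog.const_div_atTop K).add_const δ
  have hform : ∀ K : ℝ, 0 < K → ∀ n : ℕ, 2 ≤ n →
      Real.log (K * (n : ℝ) ^ δ) / Real.log n = Real.log K / Real.log n + δ := by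
    intro K hK n hn
    have hn' : (1:ℝ) < n := by exact_mod_cast hn
    have hl := Real.log_pos hn'
    rw [Real.log_mul hK.ne' (Real.rpow_pos_of_pos (by linarith) _).ne',
      Real.log_rpow (by linarith)]
    field_simp
  refine tendsto_of_tendsto_of_tendsto_of_le_of_le'
    (hlim (Real.log ((√(2 * π))⁻¹ * rexp (-2)))) (hlim (Real.log 17)) ?_ ?_
  · filter_upwards [eventually_ge_atTop n₀, eventually_ge_atTop 2] with n h1 h2
    have hn' : (1:ℝ) < n := by exact_mod_cast h2
    rw [← hform _ hc n h2]
    have hp : 0 < (n : ℝ) ^ δ := Real.rpow_pos_of_pos (by linarith) _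
    exact div_le_div_of_nonneg_right (Real.log_le_log (by positivity) (h n h1).1)
      (Real.log_pos hn').le
  · filter_upwards [eventually_ge_atTop n₀, eventually_ge_atTop 2] with n h1 h2
    have hn' : (1:ℝ) < n := by exact_mod_cast h2
    rw [← hform _ (by norm_num) n h2]
    have hp : 0 < (n : ℝ) ^ δ := Real.rpow_pos_of_pos (by linarith) _
    exact div_le_div_of_nonneg_right
      (Real.log_le_log (lt_of_lt_of_le (by positivity) (h n h1).1) (h n h1).2)
      (Real.log_pos hn').le

end
end
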